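/- arXiv:1712.06392 — 2 statements merged into one kernel-verified Lean document; each statement's English description precedes it below -/
import Mathlib

section
/- Let K be an algebraically closed field of characteristic 0, let R = K[x1,…,x5] be the standard graded polynomial ring, and let I ⊆ R be a homogeneous ideal such that the graded K-algebra A = R/I has Hilbert function (1,5,5,1) and is Gorenstein. Then A is smoothable (with d = 12). -/
open TensorProduct in
/-- A commutative `K`-algebra `A` (of dimension `d`) is *smoothable* if there is a commutative
`K[[t]]`-algebra `B`, free of rank `d` as a `K[[t]]`-module, with `B/(t)B ≅ A` as a `K`-algebra
and `B ⊗_{K[[t]]} K((t))` étale over the Laurent series field `K((t))`. -/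
def IsSmoothable (K : Type) [Field K] (A : Type) [CommRing A] [Algebra K A] (d : ℕ) : Prop :=
  ∃ (B : Type) (_ : CommRing B) (_ : Algebra (PowerSeries K) B) (_ : Algebra K B)
    (_ : IsScalarTower K (PowerSeries K) B),
    Module.Free (PowerSeries K) B ∧
    Module.finrank (PowerSeries K) B = d ∧
    Nonempty ((B ⧸ Ideal.span {(algebraMap (PowerSeries K) B) PowerSeries.X}) ≃ₐ[K] A) ∧
    Algebra.Etale (LaurentSeries K) ((LaurentSeries K) ⊗[PowerSeries K] B)

/-- The degree-`t` graded piece of `R/I`: the image in `R/I` of the space of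
degree-`t` homogeneous polynomials. -/
noncomputable def gradedPiece (K : Type) [Field K] (n : ℕ)
    (I : Ideal (MvPolynomial (Fin n) K)) (t : ℕ) :
    Submodule K (MvPolynomial (Fin n) K ⧸ I) :=
  Submodule.map (Ideal.Quotient.mkₐ K I).toLinearMap (MvPolynomial.homogeneousSubmodule (Fin n) K t)

/-- The socle of `A = R/I`: the subspace `{a ∈ A : a · x̄ᵢ = 0 for all i}`. -/
noncomputable def socle (K : Type) [Field K] (n : ℕ) (I : Ideal (MvPolynomial (Fin n) K)) :
    Submodule K (MvPolynomial (Fin n) K ⧸ I) :=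
  ⨅ i : Fin n, LinearMap.ker (LinearMap.mulRight K (Ideal.Quotient.mk I (MvPolynomial.X i)))

/-- Twelve points of affine five-space, in homogeneous coordinates `(1, p₁, …, p₅)`, lying on an
arithmetically Gorenstein set built from the conference matrix of order six. -/
def conferencePoint (K : Type) [Field K] : Fin 6 ⊕ Fin 6 → Fin 6 → K :=
  Sum.elim
    ![![1, 0, 0, 0, 0, 0], ![1, 1, 0, 0, 0, 0], ![1, 0, 1, 0, 0, 0], ![1, 0, 0, 1, 0, 0],
      ![1, 0, 0, 0, 1, 0], ![1, 0, 0, 0, 0, 1]]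
    ![![1, 1 / 5, 1 / 5, 1 / 5, 1 / 5, 1 / 5], ![1, 0, 1, -1, -1, 1], ![1, 1, 0, 1, -1, -1],
      ![1, -1, 1, 0, 1, -1], ![1, -1, -1, 1, 0, 1], ![1, 1, -1, -1, 1, 0]]

def conferenceWeight (K : Type) [Field K] : Fin 6 ⊕ Fin 6 → K :=
  Sum.elim (fun _ => 5) ![-25, -1, -1, -1, -1, -1]

lemma sum_conferenceWeight_mul {K : Type} [Field K] [CharZero K] (i j : Fin 6) :
    ∑ m, conferenceWeight K m * conferencePoint K m i * conferencePoint K m j = 0 := by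
  fin_cases i <;> fin_cases j <;>
    simp [conferenceWeight, conferencePoint, Fin.sum_univ_six] <;> norm_num

lemma forall_fin_six {p : Fin 6 → Prop} :
    (∀ i, p i) ↔ p 0 ∧ p 1 ∧ p 2 ∧ p 3 ∧ p 4 ∧ p 5 := by
  simp [Fin.forall_fin_succ]

set_option maxHeartbeats 1000000 in
lemma trilinear_eq_zero {K : Type} [Field K] [CharZero K] (T : Fin 6 → Fin 6 → Fin 6 → K)
    (h₁ : ∀ i j k, T j i k = T i j k) (h₂ : ∀ i j k, T i k j = T i j k)
    (h : ∀ m k, ∑ i, ∑ j, conferencePoint K m i * conferencePoint K m j * T i j k = 0) : T = 0 := by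
  have s₁ : ∀ i j k, i < j → T j i k = T i j k := fun i j k _ => h₁ i j k
  have s₂ : ∀ i j k, j < k → T i k j = T i j k := fun i j k _ => h₂ i j k
  have a0 := h (Sum.inl 0)
  have a1 := h (Sum.inl 1)
  have a2 := h (Sum.inl 2)
  have a3 := h (Sum.inl 3)
  have a4 := h (Sum.inl 4)
  have a5 := h (Sum.inl 5)
  simp only [forall_fin_six, conferencePoint, Fin.sum_univ_six] at a0
  simp [s₁, s₂, -mul_eq_zero, -neg_eq_zero] at a0
  simp [forall_fin_six, conferencePoint, Fin.sum_univ_six, s₁, s₂, -mul_eq_zero,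
    -neg_eq_zero, a0] at a1 a2 a3 a4 a5
  have d : ∀ i : Fin 6, T 0 i i = 0 ∧ T i i i = 0 := by
    simp only [Fin.forall_fin_succ]
    simp
    grind
  have b0 := h (Sum.inr 0)
  have b1 := h (Sum.inr 1)
  have b2 := h (Sum.inr 2)
  have b3 := h (Sum.inr 3)
  have b4 := h (Sum.inr 4)
  have b5 := h (Sum.inr 5)
  simp [forall_fin_six, conferencePoint, Fin.sum_univ_six, s₁, s₂, -mul_eq_zero,
    -neg_eq_zero, a0, d] at b0 b1 b2 b3 b4 b5
  have key : T 0 1 2 = 0 ∧ T 0 1 3 = 0 ∧ T 0 1 4 = 0 ∧ T 0 1 5 = 0 ∧ T 0 2 3 = 0 ∧ T 0 2 4 = 0 ∧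
      T 0 2 5 = 0 ∧ T 0 3 4 = 0 ∧ T 0 3 5 = 0 ∧ T 0 4 5 = 0 ∧ T 1 2 3 = 0 ∧ T 1 2 4 = 0 ∧
      T 1 2 5 = 0 ∧ T 1 3 4 = 0 ∧ T 1 3 5 = 0 ∧ T 1 4 5 = 0 ∧ T 2 3 4 = 0 ∧ T 2 3 5 = 0 ∧
      T 2 4 5 = 0 ∧ T 3 4 5 = 0 := by
    clear h h₁ h₂ s₁ s₂ d a0
    grind
  clear b0 b1 b2 b3 b4 b5
  simp [key, d] at a1 a2 a3 a4 a5
  funext i j k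
  revert i j k
  simp [forall_fin_six, s₁, s₂, a0, a1, a2, a3, a4, a5, key, d]

lemma conferencePoint_zero {K : Type} [Field K] (m : Fin 6 ⊕ Fin 6) :
    conferencePoint K m 0 = 1 := by
  rcases m with m | m <;> fin_cases m <;> rfl

lemma conferenceWeight_ne_zero {K : Type} [Field K] [CharZero K] (m : Fin 6 ⊕ Fin 6) :
    conferenceWeight K m ≠ 0 := by
  rcases m with m | m <;> fin_cases m <;> simp [conferenceWeight]

/-- If no nonzero cubic form is singular at every point `p m`, then values and directional
derivatives at these points span the symmetric tensors. -/
lemma exists_tangent_eq {K ι κ : Type} [Field K] [CharZero K] [Fintype ι] [DecidableEq ι]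
    [Fintype κ] [DecidableEq κ] (o : κ) (p : ι → κ → K) (w : ι → K) (hp : ∀ m, p m o = 1)
    (hw : ∀ m, w m ≠ 0)
    (hsing : ∀ T : κ → κ → κ → K, (∀ i j k, T j i k = T i j k) → (∀ i j k, T i k j = T i j k) →
      (∀ m k, ∑ i, ∑ j, p m i * p m j * T i j k = 0) → T = 0)
    (e : κ → κ → κ → K)
    (h₁ : ∀ i j k, e j i k = e i j k) (h₂ : ∀ i j k, e i k j = e i j k) :
    ∃ (u : ι → K) (v : ι → κ → K), (∀ m, v m o = 0) ∧
      ∀ i j k, ∑ m, (u m * p m i * p m j * p m k +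
        w m * (v m i * p m j * p m k + p m i * v m j * p m k + p m i * p m j * v m k)) =
          e i j k := by
  let ε : κ → K := fun i => if i = o then 0 else 1
  let D : ((ι → K) × (ι → κ → K)) →ₗ[K] (κ × κ × κ → K) :=
    { toFun := fun x t => ∑ m, (x.1 m * p m t.1 * p m t.2.1 * p m t.2.2 +
        w m * (ε t.1 * x.2 m t.1 * p m t.2.1 * p m t.2.2 +
          p m t.1 * (ε t.2.1 * x.2 m t.2.1) * p m t.2.2 +
          p m t.1 * p m t.2.1 * (ε t.2.2 * x.2 m t.2.2)))
      map_add' := fun x y => by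
        funext t
        simp only [Pi.add_apply, Prod.fst_add, Prod.snd_add, ← Finset.sum_add_distrib]
        exact Finset.sum_congr rfl fun m _ => by ring
      map_smul' := fun r x => by
        funext t
        simp only [Pi.smul_apply, Prod.smul_fst, Prod.smul_snd, smul_eq_mul, Finset.mul_sum,
          RingHom.id_apply]
        exact Finset.sum_congr rfl fun m _ => by ring }
  suffices h : (fun t : κ × κ × κ => e t.1 t.2.1 t.2.2) ∈ LinearMap.range D by
    obtain ⟨x, hx⟩ := h
    refine ⟨x.1, fun m i => ε i * x.2 m i, fun m => by simp [ε], fun i j k => ?_⟩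
    have := congrFun hx (i, j, k)
    simpa [D] using this
  by_contra hcon
  obtain ⟨φ, hφ, hker⟩ := Submodule.exists_le_ker_of_notMem hcon
  let T : κ → κ → κ → K := fun i j k => φ (fun t => if (i, j, k) = t then 1 else 0)
  have hT : ∀ f : κ × κ × κ → K, φ f = ∑ i, ∑ j, ∑ k, f (i, j, k) * T i j k := by
    intro f
    rw [LinearMap.pi_apply_eq_sum_univ φ f]
    simp [Fintype.sum_prod_type, T]
  have hsw₁ : ∀ F : κ → κ → κ → K, ∑ i, ∑ j, ∑ k, F j i k = ∑ i, ∑ j, ∑ k, F i j k :=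
    fun F => Finset.sum_comm
  have hsw₂ : ∀ F : κ → κ → κ → K, ∑ i, ∑ j, ∑ k, F i k j = ∑ i, ∑ j, ∑ k, F i j k :=
    fun F => Finset.sum_congr rfl fun i _ => Finset.sum_comm
  have hval : ∀ m, ∑ i, ∑ j, ∑ k, p m i * p m j * p m k * T i j k = 0 := by
    intro m
    have := hker ⟨(Pi.single m 1, 0), rfl⟩
    rw [LinearMap.mem_ker, hT] at this
    simpa [D, Pi.single_apply, ite_mul] using this
  have hder : ∀ m l, l ≠ o → ∑ i, ∑ j, p m i * p m j * (T l i j + T i l j + T i j l) = 0 := by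
    intro m l hl
    have := hker ⟨(0, Pi.single m (Pi.single l 1)), rfl⟩
    rw [LinearMap.mem_ker, hT] at this
    have hx : ∀ i j k, D (0, Pi.single m (Pi.single l 1)) (i, j, k) =
        w m * ((if i = l then 1 else 0) * p m j * p m k + p m i * (if j = l then 1 else 0) * p m k
          + p m i * p m j * (if k = l then 1 else 0)) := by
      intro i j k
      have hε : ∀ i m', ε i * (Pi.single m (Pi.single l 1) : ι → κ → K) m' i =
          if m' = m then (if i = l then 1 else 0) else 0 := by
        intro i m'
        by_cases hm : m' = m
        · subst hm
          by_cases hi : i = l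
          · subst hi; simp [ε, hl]
          · simp [hi]
        · simp [hm]
      simp only [D, LinearMap.coe_mk, AddHom.coe_mk, hε]
      rw [Finset.sum_eq_single m]
      · simp
      · intro b _ hb
        simp [hb]
      · simp
    simp only [hx, add_mul, mul_add, Finset.sum_add_distrib] at this
    simp only [mul_add, Finset.sum_add_distrib]
    apply (mul_right_injective₀ (hw m))
    refine Eq.trans ?_ (this.trans (mul_zero (w m)).symm)
    dsimp only
    rw [mul_add, mul_add]
    congr 1
    · congr 1
      · symm
        rw [Finset.sum_eq_single l]
        · simp [Finset.mul_sum, mul_assoc]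
        · intro b _ hb
          simp [hb]
        · simp
      · simp [Finset.mul_sum, mul_assoc]
    · simp [Finset.mul_sum, mul_assoc]
  let S : κ → κ → κ → K := fun i j k =>
    T i j k + T i k j + T j i k + T j k i + T k i j + T k j i
  have hsym : ∀ g : κ → κ → κ → K, (∀ i j k, g j i k = g i j k) → (∀ i j k, g i k j = g i j k) →
      ∑ i, ∑ j, ∑ k, g i j k * S i j k = 6 * ∑ i, ∑ j, ∑ k, g i j k * T i j k := by
    intro g g₁ g₂
    have e₁ := hsw₂ fun i j k => g i j k * T i j k
    have e₂ := hsw₁ fun i j k => g i j k * T i j k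
    have e₃ := hsw₁ fun i j k => g i k j * T i k j
    have e₄ := hsw₂ fun i j k => g j i k * T j i k
    have e₅ := hsw₂ fun i j k => g j k i * T j k i
    simp only [g₁, g₂] at e₁ e₂ e₃ e₄ e₅ ⊢
    simp only [S, mul_add, Finset.sum_add_distrib]
    linear_combination 3 * e₁ + 2 * e₂ + 2 * e₃ + e₄ + e₅
  have hS : S = 0 := by
    apply hsing S (fun i j k => by simp only [S]; ring) (fun i j k => by simp only [S]; ring)
    have hne : ∀ m l, l ≠ o → ∑ i, ∑ j, p m i * p m j * S i j l = 0 := by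
      intro m l hl
      have h := hder m l hl
      have h' := h
      rw [Finset.sum_comm] at h'
      have := congrArg₂ (· + ·) h h'
      simp only [← Finset.sum_add_distrib, add_zero] at this
      rw [← this]
      refine Finset.sum_congr rfl fun i _ => Finset.sum_congr rfl fun j _ => ?_
      simp only [S]
      ring
    intro m l
    rcases eq_or_ne l o with rfl | hl
    · have hall : ∑ k, p m k * ∑ i, ∑ j, p m i * p m j * S i j k = 0 := by
        have := hsym (fun i j k => p m i * p m j * p m k) (fun i j k => by ring) fun i j k => by ring
        rw [hval, mul_zero] at this
        rw [← this]
        simp only [Finset.mul_sum]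
        rw [Finset.sum_comm]
        refine Finset.sum_congr rfl fun i _ => ?_
        rw [Finset.sum_comm]
        refine Finset.sum_congr rfl fun j _ => Finset.sum_congr rfl fun k _ => by ring
      rw [Finset.sum_eq_single l (fun b _ hb => by rw [hne m b hb, mul_zero]) (by simp), hp,
        one_mul] at hall
      exact hall
    · exact hne m l hl
  apply hφ
  rw [hT]
  have := hsym e h₁ h₂
  simp only [hS, Pi.zero_apply, mul_zero, Finset.sum_const_zero] at this
  simpa using this.symm

open Polynomial in
/-- A system of cubic moments with surjective differential at `(w, p)` can be solved along any
polynomial path of moments starting at those of `(w, p)`, to any finite order. -/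
lemma exists_truncated_moments {K ι κ : Type} [Field K] [Fintype ι] (o : κ) (p : ι → κ → K)
    (w : ι → K) (hp : ∀ m, p m o = 1)
    (htan : ∀ e : κ → κ → κ → K, (∀ i j k, e j i k = e i j k) → (∀ i j k, e i k j = e i j k) →
      ∃ (u : ι → K) (v : ι → κ → K), (∀ m, v m o = 0) ∧
      ∀ i j k, ∑ m, (u m * p m i * p m j * p m k +
        w m * (v m i * p m j * p m k + p m i * v m j * p m k + p m i * p m j * v m k)) = e i j k)
    (L : κ → κ → κ → K[X]) (hL₁ : ∀ i j k, L j i k = L i j k) (hL₂ : ∀ i j k, L i k j = L i j k)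
    (hL : ∀ i j k, (L i j k).eval 0 = ∑ m, w m * p m i * p m j * p m k) (N : ℕ) :
    ∃ (c : ι → K[X]) (q : ι → κ → K[X]), (∀ m, q m o = 1) ∧ (∀ m, (c m).eval 0 = w m) ∧
      (∀ m i, (q m i).eval 0 = p m i) ∧
      ∀ i j k, X ^ (N + 1) ∣ ∑ m, c m * q m i * q m j * q m k - L i j k := by
  have hX : ∀ f : K[X], X ∣ f ↔ f.eval 0 = 0 := fun f => by
    rw [X_dvd_iff, coeff_zero_eq_eval_zero]
  induction N with
  | zero =>
    refine ⟨fun m => C (w m), fun m i => C (p m i), fun m => by simp [hp], by simp, by simp, ?_⟩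
    intro i j k
    rw [zero_add, pow_one, hX]
    simp [eval_finsetSum, hL]
  | succ N ih =>
    obtain ⟨c, q, hq, hc, hqp, h⟩ := ih
    choose E hE using h
    have hX0 : (X : K[X]) ^ (N + 1) ≠ 0 := pow_ne_zero _ X_ne_zero
    obtain ⟨u, v, hv, huv⟩ := htan (fun i j k => -(E i j k).eval 0)
      (fun i j k => by
        congr 2
        apply mul_left_cancel₀ hX0
        rw [← hE, ← hE, hL₁]
        congr 1
        exact Finset.sum_congr rfl fun m _ => by ring)
      (fun i j k => by
        congr 2
        apply mul_left_cancel₀ hX0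
        rw [← hE, ← hE, hL₂]
        congr 1
        exact Finset.sum_congr rfl fun m _ => by ring)
    refine ⟨fun m => c m + X ^ (N + 1) * C (u m), fun m i => q m i + X ^ (N + 1) * C (v m i),
      by simp [hq, hv], by simp [hc], by simp [hqp], fun i j k => ?_⟩
    have key : ∑ m, (c m + X ^ (N + 1) * C (u m)) * (q m i + X ^ (N + 1) * C (v m i)) *
        (q m j + X ^ (N + 1) * C (v m j)) * (q m k + X ^ (N + 1) * C (v m k)) - L i j k =
        X ^ (N + 1) * (E i j k + ∑ m, (
          C (u m) * (q m i + X ^ (N + 1) * C (v m i)) *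
            (q m j + X ^ (N + 1) * C (v m j)) * (q m k + X ^ (N + 1) * C (v m k)) +
          c m * C (v m i) * (q m j + X ^ (N + 1) * C (v m j)) * (q m k + X ^ (N + 1) * C (v m k)) +
          c m * q m i * C (v m j) * (q m k + X ^ (N + 1) * C (v m k)) +
          c m * q m i * q m j * C (v m k))) := by
      rw [mul_add, ← hE, sub_add_eq_add_sub, Finset.mul_sum, ← Finset.sum_add_distrib]
      congr 1
      exact Finset.sum_congr rfl fun m _ => by ring
    rw [key, pow_succ _ (N + 1)]
    refine mul_dvd_mul_left _ ((hX _).2 ?_)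
    have := huv i j k
    simp only [eval_add, eval_finsetSum, eval_mul, eval_C, eval_pow, eval_X, hc, hqp]
    rw [← add_right_inj (-eval 0 (E i j k)), ← this]
    simp only [ne_eq, Nat.add_eq_zero_iff, one_ne_zero, and_false, not_false_eq_true, zero_pow,
      zero_mul, add_zero]
    rw [this, neg_add_cancel_left, ← this]
    exact Finset.sum_congr rfl fun m _ => by ring

open Polynomial in
/-- A system of polynomial equations over `K[X]` that can be solved modulo every power of `X` has
a solution in a finite extension of the fraction field of `K[X]`. -/
lemma exists_finite_extension_solution {K σ : Type} [Field K] [Finite σ]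
    (S : Set (MvPolynomial σ K[X]))
    (hS : ∀ N : ℕ, ∃ x : σ → K[X], ∀ f ∈ S, X ^ (N + 1) ∣ MvPolynomial.eval x f) :
    ∃ (E : Type) (_ : Field E) (_ : Algebra K[X] E) (_ : Algebra (FractionRing K[X]) E)
      (_ : IsScalarTower K[X] (FractionRing K[X]) E)
      (_ : FiniteDimensional (FractionRing K[X]) E) (x : σ → E),
      ∀ f ∈ S, MvPolynomial.aeval x f = 0 := by
  have hdisj : Disjoint ((nonZeroDivisors K[X]).map (MvPolynomial.C (σ := σ)) :
      Set (MvPolynomial σ K[X])) (Ideal.span S : Set (MvPolynomial σ K[X])) := by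
    rw [Set.disjoint_left]
    rintro _ ⟨g, hg, rfl⟩ hmem
    obtain ⟨x, hx⟩ := hS g.natDegree
    have hle : Ideal.span S ≤ (Ideal.span {X ^ (g.natDegree + 1)}).comap (MvPolynomial.eval x) :=
      Ideal.span_le.2 fun f hf => Ideal.mem_comap.2 (Ideal.mem_span_singleton.2 (hx f hf))
    have h := Ideal.mem_span_singleton.1 (Ideal.mem_comap.1 (hle hmem))
    have h' := natDegree_le_of_dvd h (by simpa using nonZeroDivisors.ne_zero hg)
    simp at h'
  let _ : Algebra (MvPolynomial σ K[X]) (MvPolynomial σ (FractionRing K[X])) :=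
    MvPolynomial.algebraMvPolynomial
  have hne := (IsLocalization.map_algebraMap_ne_top_iff_disjoint
    ((nonZeroDivisors K[X]).map (MvPolynomial.C (σ := σ)))
    (MvPolynomial σ (FractionRing K[X])) (Ideal.span S)).2 hdisj
  obtain ⟨M, hM, hle⟩ := Ideal.exists_le_maximal _ hne
  let _ : Field (MvPolynomial σ (FractionRing K[X]) ⧸ M) := Ideal.Quotient.field M
  have : Algebra.FiniteType (FractionRing K[X]) (MvPolynomial σ (FractionRing K[X]) ⧸ M) :=
    inferInstance
  refine ⟨MvPolynomial σ (FractionRing K[X]) ⧸ M, inferInstance, inferInstance, inferInstance,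
    inferInstance, finite_of_finite_type_of_isJacobsonRing _ _,
    fun i => Ideal.Quotient.mk M (MvPolynomial.X i), fun f hf => ?_⟩
  have h0 : Ideal.Quotient.mk M (algebraMap _ _ f) = 0 := Ideal.Quotient.eq_zero_iff_mem.2
    (hle (Ideal.mem_map_of_mem _ (Ideal.subset_span hf)))
  rw [← h0]
  have : (MvPolynomial.aeval fun i => Ideal.Quotient.mk M (MvPolynomial.X i) :
      MvPolynomial σ K[X] →ₐ[K[X]] _) = ((Ideal.Quotient.mkₐ (FractionRing K[X]) M).restrictScalars K[X]).comp
      (IsScalarTower.toAlgHom K[X] (MvPolynomial σ K[X]) (MvPolynomial σ (FractionRing K[X]))) := by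
    ext i
    rw [MvPolynomial.aeval_X]
    exact congrArg (Ideal.Quotient.mk M) (MvPolynomial.map_X _ i).symm
  rw [this]
  rfl

open Polynomial in
lemma X_pow_dvd_of_pow_dvd_aeval {K V : Type} [Field K] [CommRing V] [IsDomain V] [Algebra K V]
    (res : V →ₐ[K] K) {π : V} (hπ : π ≠ 0) (hres : res π = 0) (n : ℕ) :
    ∀ P : K[X], π ^ n ∣ aeval π P → X ^ n ∣ P := by
  induction n with
  | zero => simp
  | succ n ih =>
    intro P h
    have h0 : P.coeff 0 = 0 := by
      have h1 : π ∣ aeval π P := (dvd_pow_self π n.succ_ne_zero).trans h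
      obtain ⟨b, hb⟩ := h1
      have := congrArg res hb
      rw [map_mul, hres, zero_mul, ← aeval_algHom_apply, hres] at this
      rw [coeff_zero_eq_aeval_zero, this]
    obtain ⟨Q, rfl⟩ := X_dvd_iff.2 h0
    rw [pow_succ'] at h ⊢
    rw [map_mul, aeval_X] at h
    exact mul_dvd_mul_left _ (ih Q ((mul_dvd_mul_iff_left hπ).1 h))

open Polynomial in
/-- Power series expansion along a uniformizer `π` of a local ring with coefficient field `K`. -/
lemma exists_algHom_powerSeries {K V : Type} [Field K] [CommRing V] [IsDomain V] [IsNoetherianRing V]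
    [Algebra K V] (res : V →ₐ[K] K) {π : V} (hπ : π ≠ 0) (hker : ∀ a, res a = 0 ↔ π ∣ a) :
    ∃ ψ : V →ₐ[K] PowerSeries K, Function.Injective ψ ∧
      ∀ a, PowerSeries.constantCoeff (ψ a) = res a := by
  have hres : res π = 0 := (hker π).2 dvd_rfl
  let R : V → PowerSeries K → Prop := fun a f => ∀ n : ℕ, ∃ P : K[X],
    PowerSeries.X ^ n ∣ f - (P : PowerSeries K) ∧ π ^ n ∣ a - aeval π P
  have hzero : ∀ f, R 0 f → f = 0 := by
    intro f hf
    ext n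
    obtain ⟨P, h₁, h₂⟩ := hf (n + 1)
    rw [zero_sub, dvd_neg] at h₂
    have h₃ : (PowerSeries.X : PowerSeries K) ^ (n + 1) ∣ P := by
      obtain ⟨Q, rfl⟩ := X_pow_dvd_of_pow_dvd_aeval res hπ hres _ P h₂
      exact ⟨Q, by simp⟩
    have h₄ : (PowerSeries.X : PowerSeries K) ^ (n + 1) ∣ f := by
      simpa using dvd_add h₁ h₃
    exact PowerSeries.X_pow_dvd_iff.1 h₄ n n.lt_succ_self
  have hadd : ∀ a b f g, R a f → R b g → R (a + b) (f + g) := by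
    intro a b f g ha hb n
    obtain ⟨P, h₁, h₂⟩ := ha n
    obtain ⟨Q, h₃, h₄⟩ := hb n
    refine ⟨P + Q, ?_, ?_⟩
    · convert dvd_add h₁ h₃ using 1
      push_cast; ring
    · convert dvd_add h₂ h₄ using 1
      rw [map_add]; ring
  have hmul : ∀ a b f g, R a f → R b g → R (a * b) (f * g) := by
    intro a b f g ha hb n
    obtain ⟨P, h₁, h₂⟩ := ha n
    obtain ⟨Q, h₃, h₄⟩ := hb n
    refine ⟨P * Q, ?_, ?_⟩
    · convert dvd_add (h₁.mul_right g) (h₃.mul_left (P : PowerSeries K)) using 1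
      push_cast; ring
    · convert dvd_add (h₂.mul_right b) (h₄.mul_left (aeval π P)) using 1
      rw [map_mul]; ring
  have hneg : ∀ a f, R a f → R (-a) (-f) := by
    intro a f ha n
    obtain ⟨P, h₁, h₂⟩ := ha n
    refine ⟨-P, ?_, ?_⟩
    · convert (dvd_neg.2 h₁) using 1
      push_cast; ring
    · convert (dvd_neg.2 h₂) using 1
      rw [map_neg]; ring
  have hC : ∀ k : K, R (algebraMap K V k) (PowerSeries.C k) := fun k n => ⟨C k, by simp, by simp⟩
  have huniq : ∀ a f g, R a f → R a g → f = g := by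
    intro a f g hf hg
    have := hadd _ _ _ _ hf (hneg _ _ hg)
    rw [add_neg_cancel] at this
    rw [← sub_eq_zero, sub_eq_add_neg]
    exact hzero _ this
  have hex : ∀ a, ∃ f, R a f := by
    have hd : ∀ a, ∃ b, a = algebraMap K V (res a) + π * b := by
      intro a
      obtain ⟨b, hb⟩ := (hker (a - algebraMap K V (res a))).1 (by simp)
      exact ⟨b, by rw [← hb]; ring⟩
    choose d hd using hd
    intro a
    refine ⟨PowerSeries.mk fun n => res (d^[n] a), fun n =>
      ⟨∑ i ∈ Finset.range n, C (res (d^[i] a)) * X ^ i, ?_, ?_⟩⟩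
    · rw [PowerSeries.X_pow_dvd_iff]
      intro m hm
      simp [hm, Polynomial.coeff_X_pow]
    · have : a - aeval π (∑ i ∈ Finset.range n, C (res (d^[i] a)) * X ^ i) = π ^ n * d^[n] a := by
        induction n with
        | zero => simp
        | succ n ih =>
          rw [Finset.sum_range_succ, map_add, ← sub_sub, ih, Function.iterate_succ_apply',
            sub_eq_iff_eq_add]
          conv_lhs => rw [hd (d^[n] a)]
          simp
          ring
      exact ⟨_, this⟩
  choose ψ hψ using hex
  refine ⟨AlgHom.mk' (RingHom.mk' ⟨⟨ψ, ?_⟩, ?_⟩ ?_) ?_, ?_, ?_⟩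
  · exact huniq _ _ _ (hψ 1) (by simpa using hC 1)
  · exact fun a b => huniq _ _ _ (hψ _) (hmul _ _ _ _ (hψ a) (hψ b))
  · exact fun a b => huniq _ _ _ (hψ _) (hadd _ _ _ _ (hψ a) (hψ b))
  · intro k x
    refine huniq _ _ _ (hψ _) ?_
    rw [Algebra.smul_def, PowerSeries.smul_eq_C_mul]
    exact hmul _ _ _ _ (hC k) (hψ x)
  · rw [injective_iff_map_eq_zero]
    intro a ha
    have hR : R a 0 := ha ▸ hψ a
    have hI : a ∈ (⨅ n : ℕ, Ideal.span {π} ^ n : Ideal V) := by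
      rw [Ideal.mem_iInf]
      intro n
      rw [Ideal.span_singleton_pow, Ideal.mem_span_singleton]
      obtain ⟨P, h₁, h₂⟩ := hR n
      have h₃ : X ^ n ∣ P := by
        rw [X_pow_dvd_iff]
        intro m hm
        have := PowerSeries.X_pow_dvd_iff.1 h₁ m hm
        simpa using this
      obtain ⟨Q, rfl⟩ := h₃
      have h₄ : π ^ n ∣ aeval π (X ^ n * Q) := by simp
      simpa using dvd_add h₂ h₄
    rwa [Ideal.iInf_pow_eq_bot_of_isDomain _ (fun h => ?_), Ideal.mem_bot] at hI
    have h1 : (1 : V) ∈ Ideal.span {π} := h ▸ Submodule.mem_top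
    have := (hker 1).2 (Ideal.mem_span_singleton.1 h1)
    simp at this
  · intro a
    obtain ⟨P, h₁, h₂⟩ := hψ a 1
    rw [pow_one, PowerSeries.X_dvd_iff, map_sub, sub_eq_zero] at h₁
    rw [pow_one, ← hker, map_sub, sub_eq_zero, ← aeval_algHom_apply, hres] at h₂
    refine h₁.trans (Eq.trans ?_ h₂.symm)
    rw [← coeff_zero_eq_aeval_zero]
    simp

/-- Expansion of the elements of a Dedekind domain at a maximal ideal with residue field `K`. -/
lemma exists_ringHom_powerSeries_of_isDedekindDomain {K R : Type} [Field K] [CommRing R]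
    [IsDedekindDomain R] (P : Ideal R) [P.IsMaximal] (hP : P ≠ ⊥) (f : K →+* R)
    (hf : Function.Bijective ((Ideal.Quotient.mk P).comp f)) :
    ∃ ψ : R →+* PowerSeries K, Function.Injective ψ ∧ (∀ k, ψ (f k) = PowerSeries.C k) ∧
      ∀ x ∈ P, PowerSeries.constantCoeff (ψ x) = 0 := by
  suffices h : ∀ (V : Type) [CommRing V] [IsDomain V] [Algebra R V] [IsLocalization.AtPrime V P],
      ∃ ψ : R →+* PowerSeries K, Function.Injective ψ ∧ (∀ k, ψ (f k) = PowerSeries.C k) ∧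
        ∀ x ∈ P, PowerSeries.constantCoeff (ψ x) = 0 from
    h (Localization.AtPrime P)
  intro V _ _ _ _
  have : IsDiscreteValuationRing V :=
    IsLocalization.AtPrime.isDiscreteValuationRing_of_dedekind_domain R hP V
  let e₁ : K ≃+* R ⧸ P := RingEquiv.ofBijective _ hf
  let e₂ : R ⧸ P ≃+* V ⧸ IsLocalRing.maximalIdeal V :=
    IsLocalization.AtPrime.equivQuotMaximalIdeal P V
  let r : V →+* K := (e₁.trans e₂).symm.toRingHom.comp (Ideal.Quotient.mk (IsLocalRing.maximalIdeal V))
  have hr : ∀ x : V, r x = 0 ↔ x ∈ IsLocalRing.maximalIdeal V := by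
    intro x
    rw [← Ideal.Quotient.eq_zero_iff_mem]
    exact map_eq_zero_iff (e₁.trans e₂).symm (e₁.trans e₂).symm.injective
  have hrf : ∀ k, r (algebraMap R V (f k)) = k := by
    intro k
    have h : Ideal.Quotient.mk (IsLocalRing.maximalIdeal V) (algebraMap R V (f k)) = (e₁.trans e₂) k := rfl
    change (e₁.trans e₂).symm (Ideal.Quotient.mk (IsLocalRing.maximalIdeal V) (algebraMap R V (f k))) = k
    rw [h, RingEquiv.symm_apply_apply]
  let _ : Algebra K V := ((algebraMap R V).comp f).toAlgebra
  let res : V →ₐ[K] K := { r with commutes' := hrf }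
  obtain ⟨π, hπ⟩ := IsDiscreteValuationRing.exists_irreducible V
  obtain ⟨ψ, hψ, hψc⟩ := exists_algHom_powerSeries res hπ.ne_zero (fun x => by
    rw [← Ideal.mem_span_singleton, ← hπ.maximalIdeal_eq]
    exact hr x)
  refine ⟨(ψ : V →+* PowerSeries K).comp (algebraMap R V), ?_, fun k => ?_, fun x hx => ?_⟩
  · rw [RingHom.coe_comp]
    exact hψ.comp (IsLocalization.injective V P.primeCompl_le_nonZeroDivisors)
  · exact ψ.commutes k
  · exact (hψc _).trans ((hr _).2 ((IsLocalization.AtPrime.to_map_mem_maximal_iff V P x).2 hx))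

open Polynomial in
/-- Every finite extension of `FractionRing K[X]` embeds in the Laurent series field, in such a way
that `K[X]` is mapped to power series and the place at `a` becomes the `T`-adic place. -/
lemma exists_ringHom_laurentSeries {K E : Type} [Field K] [IsAlgClosed K] [CharZero K] [Field E]
    [Algebra K[X] E] [Algebra (FractionRing K[X]) E] [IsScalarTower K[X] (FractionRing K[X]) E]
    [FiniteDimensional (FractionRing K[X]) E] (a : K) :
    ∃ (θ : E →+* LaurentSeries K) (φ : K[X] →+* PowerSeries K),
      (∀ k, φ (C k) = PowerSeries.C k) ∧ (∀ q, PowerSeries.constantCoeff (φ q) = q.eval a) ∧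
      ∀ q, θ (algebraMap K[X] E q) = (φ q : LaurentSeries K) := by
  let R := integralClosure K[X] E
  have : IsDedekindDomain R := integralClosure.isDedekindDomain K[X] (FractionRing K[X]) E
  have : IsFractionRing R E :=
    integralClosure.isFractionRing_of_finite_extension (FractionRing K[X]) E
  have : Algebra.IsIntegral K[X] R := inferInstance
  have hXE : Function.Injective (algebraMap K[X] E) := by
    rw [IsScalarTower.algebraMap_eq K[X] (FractionRing K[X]) E]
    exact (algebraMap (FractionRing K[X]) E).injective.comp (IsFractionRing.injective _ _)
  have hXR : Function.Injective (algebraMap K[X] R) := by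
    apply Function.Injective.of_comp (f := algebraMap R E)
    rwa [← RingHom.coe_comp, ← IsScalarTower.algebraMap_eq K[X] R E]
  have hmax : (Ideal.span {X - C a} : Ideal K[X]).IsMaximal :=
    PrincipalIdealRing.isMaximal_of_irreducible (irreducible_X_sub_C a)
  obtain ⟨P, hP, hPa⟩ := Ideal.exists_ideal_over_maximal_of_isIntegral (S := R)
    (Ideal.span {X - C a} : Ideal K[X])
    (by rw [(RingHom.injective_iff_ker_eq_bot _).1 hXR]; exact bot_le)
  have hXP : algebraMap K[X] R (X - C a) ∈ P := by
    rw [← Ideal.mem_comap, hPa]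
    exact Ideal.mem_span_singleton_self _
  have hP0 : P ≠ ⊥ := by
    rintro rfl
    rw [Ideal.mem_bot, map_eq_zero_iff _ hXR] at hXP
    exact X_sub_C_ne_zero a hXP
  let i : K →+* R := (algebraMap K[X] R).comp C
  let f : K →+* R ⧸ P := (Ideal.Quotient.mk P).comp i
  have hf : f.comp (evalRingHom a) = (Ideal.Quotient.mk P).comp (algebraMap K[X] R) := by
    apply Polynomial.ringHom_ext
    · intro k
      rw [RingHom.comp_apply, coe_evalRingHom, eval_C]
      rfl
    · have := Ideal.Quotient.eq_zero_iff_mem.2 hXP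
      rw [map_sub, map_sub, sub_eq_zero] at this
      rw [RingHom.comp_apply, coe_evalRingHom, eval_X]
      exact this.symm
  have hfint : f.IsIntegral := by
    apply RingHom.IsIntegral.tower_top (evalRingHom a)
    rw [hf]
    exact RingHom.IsIntegral.trans _ _ (algebraMap_isIntegral_iff.2 inferInstance)
      (RingHom.isIntegral_of_surjective _ Ideal.Quotient.mk_surjective)
  obtain ⟨ψ, hψ, hψi, hψP⟩ := exists_ringHom_powerSeries_of_isDedekindDomain P hP0 i
    (IsAlgClosed.ringHom_bijective_of_isIntegral f hfint)
  have hg : Function.Injective ((algebraMap (PowerSeries K) (LaurentSeries K)).comp ψ) := by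
    rw [RingHom.coe_comp]
    exact (IsFractionRing.injective (PowerSeries K) (LaurentSeries K)).comp hψ
  refine ⟨IsFractionRing.lift hg, ψ.comp (algebraMap K[X] R), hψi, ?_, ?_⟩
  · have hev : PowerSeries.constantCoeff.comp (ψ.comp (algebraMap K[X] R)) = evalRingHom a := by
      apply Polynomial.ringHom_ext
      · intro k
        have := hψi k
        simp only [i, RingHom.comp_apply] at this
        simp [this]
      · have h₁ := hψP _ hXP
        have h₂ := hψi a
        simp only [i, RingHom.comp_apply] at h₂
        rw [map_sub, map_sub, map_sub, h₂, sub_eq_zero] at h₁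
        simpa using h₁
    exact fun q => RingHom.congr_fun hev q
  · intro q
    rw [IsScalarTower.algebraMap_apply K[X] R E, IsFractionRing.lift_algebraMap]
    rfl

open Polynomial in
/-- The cubic moments of the weighted conference points deform, over Laurent series, to a family
whose moments are power series specializing to a prescribed symmetric tensor. -/
lemma exists_laurentSeries_moments {K : Type} [Field K] [IsAlgClosed K] [CharZero K]
    (τ : Fin 6 → Fin 6 → Fin 6 → K) (h₁ : ∀ i j k, τ j i k = τ i j k)
    (h₂ : ∀ i j k, τ i k j = τ i j k) (h₀ : ∀ j k, τ 0 j k = 0) :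
    ∃ (c : Fin 6 ⊕ Fin 6 → LaurentSeries K) (q : Fin 6 ⊕ Fin 6 → Fin 6 → LaurentSeries K),
      (∀ m, q m 0 = 1) ∧ ∀ i j k, ∃ g : PowerSeries K,
        ∑ m, c m * q m i * q m j * q m k = (g : LaurentSeries K) ∧
        PowerSeries.constantCoeff g = τ i j k ∧ (i = 0 → g = 0) := by
  let μ : Fin 6 → Fin 6 → Fin 6 → K := fun i j k =>
    ∑ m, conferenceWeight K m * conferencePoint K m i * conferencePoint K m j * conferencePoint K m k
  let L : Fin 6 → Fin 6 → Fin 6 → K[X] := fun i j k => C (μ i j k) + X * C (τ i j k - μ i j k)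
  have hμ₁ : ∀ i j k, μ j i k = μ i j k := fun i j k => Finset.sum_congr rfl fun m _ => by ring
  have hμ₂ : ∀ i j k, μ i k j = μ i j k := fun i j k => Finset.sum_congr rfl fun m _ => by ring
  have hL₁ : ∀ i j k, L j i k = L i j k := fun i j k => by simp only [L, h₁ i j k, hμ₁ i j k]
  have hL₂ : ∀ i j k, L i k j = L i j k := fun i j k => by simp only [L, h₂ i j k, hμ₂ i j k]
  have hL₀ : ∀ j k, L 0 j k = 0 := by
    intro j k
    have : μ 0 j k = 0 := by simp only [μ, conferencePoint_zero, mul_one, sum_conferenceWeight_mul]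
    simp [L, this, h₀]
  let F : Fin 6 → Fin 6 → Fin 6 → MvPolynomial ((Fin 6 ⊕ Fin 6) ⊕ (Fin 6 ⊕ Fin 6) × Fin 6) K[X] :=
    fun i j k => ∑ m, MvPolynomial.X (Sum.inl m) * MvPolynomial.X (Sum.inr (m, i)) *
      MvPolynomial.X (Sum.inr (m, j)) * MvPolynomial.X (Sum.inr (m, k)) - MvPolynomial.C (L i j k)
  let G : Fin 6 ⊕ Fin 6 → MvPolynomial ((Fin 6 ⊕ Fin 6) ⊕ (Fin 6 ⊕ Fin 6) × Fin 6) K[X] :=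
    fun m => MvPolynomial.X (Sum.inr (m, 0)) - 1
  let S := {f | ∃ i j k, f = F i j k} ∪ Set.range G
  obtain ⟨E, _, _, _, _, _, x, hx⟩ := exists_finite_extension_solution S fun N => by
    obtain ⟨c, q, hq, -, -, h⟩ := exists_truncated_moments 0 (conferencePoint K) (conferenceWeight K)
      conferencePoint_zero (exists_tangent_eq 0 _ _ conferencePoint_zero conferenceWeight_ne_zero
        trilinear_eq_zero) L hL₁ hL₂ (fun i j k => by
        simp only [L, eval_add, eval_mul, eval_X, eval_C, zero_mul, add_zero, μ]) N
    refine ⟨Sum.elim c fun a => q a.1 a.2, ?_⟩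
    rintro f (⟨i, j, k, rfl⟩ | ⟨m, rfl⟩)
    · simpa [F] using h i j k
    · simp [G, hq]
  obtain ⟨θ, φ, -, hφ, hθ⟩ := exists_ringHom_laurentSeries (E := E) (1 : K)
  refine ⟨fun m => θ (x (Sum.inl m)), fun m i => θ (x (Sum.inr (m, i))), fun m => ?_,
    fun i j k => ⟨φ (L i j k), ?_, ?_, ?_⟩⟩
  · have := hx (G m) (Or.inr ⟨m, rfl⟩)
    simp only [G, map_sub, MvPolynomial.aeval_X, map_one, sub_eq_zero] at this
    change θ (x (Sum.inr (m, 0))) = 1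
    rw [this, map_one]
  · have := hx (F i j k) (Or.inl ⟨i, j, k, rfl⟩)
    simp only [F, map_sub, map_sum, map_mul, MvPolynomial.aeval_X, MvPolynomial.aeval_C,
      sub_eq_zero] at this
    rw [← hθ, ← this]
    simp only [map_sum, map_mul]
  · simp [hφ, L]
  · rintro rfl
    rw [hL₀, map_zero]

lemma cons_one_X_eq_monomial {K : Type} [Field K] {n : ℕ} (i : Fin (n + 1)) :
    ∃ d : Fin n →₀ ℕ, d.degree ≤ 1 ∧
      (Fin.cons 1 MvPolynomial.X : Fin (n + 1) → MvPolynomial (Fin n) K) i =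
        MvPolynomial.monomial d 1 := by
  refine Fin.cases ⟨0, by simp, rfl⟩ (fun i => ⟨Finsupp.single i 1, by simp, rfl⟩) i

lemma exists_eq_mul_cons_of_degree_le {K : Type} [CommRing K] {n : ℕ} (d : Fin n →₀ ℕ)
    (hd : d.degree ≤ 3) :
    ∃ i j k : Fin (n + 1), (d.degree < 3 → i = 0) ∧
      MvPolynomial.monomial d (1 : K) = (Fin.cons 1 MvPolynomial.X : Fin (n + 1) → _) i *
        (Fin.cons 1 MvPolynomial.X : Fin (n + 1) → _) j *
        (Fin.cons 1 MvPolynomial.X : Fin (n + 1) → _) k := by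
  obtain ⟨s, rfl⟩ := Multiset.toFinsupp.surjective d
  have hdeg : (Multiset.toFinsupp s).degree = s.card := by
    conv_rhs => rw [← Multiset.toFinsupp_toMultiset s, Finsupp.card_toMultiset]
    rfl
  have hadd : ∀ t u : Multiset (Fin n), MvPolynomial.monomial (Multiset.toFinsupp (t + u)) (1 : K) =
      MvPolynomial.monomial (Multiset.toFinsupp t) 1 *
        MvPolynomial.monomial (Multiset.toFinsupp u) 1 := by
    intro t u
    rw [map_add, MvPolynomial.monomial_mul, mul_one]
  have hone : ∀ a : Fin n, MvPolynomial.monomial (Multiset.toFinsupp {a}) (1 : K) =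
      MvPolynomial.X a := by
    intro a
    rw [Multiset.toFinsupp_singleton]
    rfl
  rw [hdeg] at hd ⊢
  obtain h | h | h | h : s.card = 0 ∨ s.card = 1 ∨ s.card = 2 ∨ s.card = 3 := by omega
  · rw [Multiset.card_eq_zero] at h
    subst h
    exact ⟨0, 0, 0, fun _ => rfl, by simp⟩
  · obtain ⟨a, rfl⟩ := Multiset.card_eq_one.1 h
    exact ⟨0, 0, a.succ, fun _ => rfl, by rw [hone]; simp⟩
  · obtain ⟨a, b, rfl⟩ := Multiset.card_eq_two.1 h
    refine ⟨0, a.succ, b.succ, fun _ => rfl, ?_⟩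
    rw [Multiset.insert_eq_cons, ← Multiset.singleton_add, hadd, hone, hone]
    simp
  · obtain ⟨a, b, c, rfl⟩ := Multiset.card_eq_three.1 h
    refine ⟨a.succ, b.succ, c.succ, fun h' => absurd h (by omega), ?_⟩
    rw [Multiset.insert_eq_cons, Multiset.insert_eq_cons, ← Multiset.singleton_add, hadd,
      ← Multiset.singleton_add, hadd, hone, hone, hone]
    simp [mul_assoc]

/-- Rescaling points with weights whose functional has prescribed cubic part makes the functional
degenerate to that cubic part. -/
lemma exists_points_of_cubic_moments {K ι : Type} [Field K] [Fintype ι] {n : ℕ}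
    (ℓ : MvPolynomial (Fin n) K →ₗ[K] K)
    (hℓ : ∀ d : Fin n →₀ ℕ, d.degree ≠ 3 → ℓ (MvPolynomial.monomial d 1) = 0)
    (c : ι → LaurentSeries K) (q : ι → Fin (n + 1) → LaurentSeries K) (hq : ∀ m, q m 0 = 1)
    (h : ∀ i j k, ∃ g : PowerSeries K, ∑ m, c m * q m i * q m j * q m k = (g : LaurentSeries K) ∧
      PowerSeries.constantCoeff g = ℓ ((Fin.cons 1 MvPolynomial.X : Fin (n + 1) → _) i *
        (Fin.cons 1 MvPolynomial.X : Fin (n + 1) → _) j *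
        (Fin.cons 1 MvPolynomial.X : Fin (n + 1) → _) k) ∧ (i = 0 → g = 0)) :
    ∃ (P : ι → Fin n → PowerSeries K) (c' : ι → LaurentSeries K),
      ∀ f : MvPolynomial (Fin n) K, ∃ g : PowerSeries K,
        ∑ m, c' m * (MvPolynomial.aeval (P m) f : PowerSeries K) = (g : LaurentSeries K) ∧
        PowerSeries.constantCoeff g = ℓ f := by
  let T : LaurentSeries K := algebraMap (PowerSeries K) _ PowerSeries.X
  have hT : T ≠ 0 := by
    simp [T]
  obtain ⟨v, hv⟩ : ∃ v : ℕ, ∀ x : ι ⊕ (ι × Fin n), ∃ g : PowerSeries K,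
      T ^ v * Sum.elim c (fun y => q y.1 y.2.succ) x = algebraMap _ _ g := by
    obtain ⟨⟨_, v, rfl⟩, hb⟩ := IsLocalization.exist_integer_multiples_of_finite
      (Submonoid.powers (PowerSeries.X : PowerSeries K)) (S := LaurentSeries K)
      (Sum.elim c (fun y : ι × Fin n => q y.1 y.2.succ))
    refine ⟨v, fun x => ?_⟩
    obtain ⟨g, hg⟩ := hb x
    refine ⟨g, hg.symm ▸ ?_⟩
    simp [T, Algebra.smul_def]
  choose g hg using hv
  let N := 5 * v + 1
  let P : ι → Fin n → PowerSeries K := fun m i => PowerSeries.X ^ (N - v) * g (Sum.inr (m, i))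
  have hP : ∀ m i, algebraMap _ (LaurentSeries K) (P m i) = T ^ N * q m i.succ := by
    intro m i
    have := hg (Sum.inr (m, i))
    simp only [Sum.elim_inr] at this
    simp only [P, map_mul, map_pow, ← this]
    change T ^ (N - v) * _ = _
    rw [← mul_assoc, ← pow_add]
    congr 2
    omega
  have hmon : ∀ d : Fin n →₀ ℕ, ∑ m, (T ^ (3 * N))⁻¹ * c m *
      algebraMap _ (LaurentSeries K) (∏ i, P m i ^ d i) =
      (T ^ (3 * N))⁻¹ * T ^ (N * d.degree) * ∑ m, c m * ∏ i, q m i.succ ^ d i := by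
    intro d
    rw [Finset.mul_sum]
    refine Finset.sum_congr rfl fun m _ => ?_
    simp only [map_prod, map_pow, hP, mul_pow, Finset.prod_mul_distrib, ← pow_mul,
      Finset.prod_pow_eq_pow_sum, ← Finset.mul_sum, Finsupp.degree_eq_sum]
    ring
  refine ⟨P, fun m => (T ^ (3 * N))⁻¹ * c m, fun f => ?_⟩
  induction f using MvPolynomial.induction_on' with
  | add f₁ f₂ ih₁ ih₂ =>
    obtain ⟨g₁, h₁, h₁'⟩ := ih₁
    obtain ⟨g₂, h₂, h₂'⟩ := ih₂
    refine ⟨g₁ + g₂, ?_, by rw [map_add, map_add, h₁', h₂']⟩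
    change _ = algebraMap (PowerSeries K) (LaurentSeries K) (g₁ + g₂)
    rw [map_add]
    refine Eq.trans ?_ (congrArg₂ (· + ·) h₁ h₂)
    rw [← Finset.sum_add_distrib]
    refine Finset.sum_congr rfl fun m _ => ?_
    change _ * algebraMap (PowerSeries K) (LaurentSeries K) _ = _
    rw [map_add, map_add, mul_add]
    rfl
  | monomial d a =>
    suffices hs : ∃ g : PowerSeries K, ∑ m, (T ^ (3 * N))⁻¹ * c m *
        algebraMap _ (LaurentSeries K) (∏ i, P m i ^ d i) = algebraMap _ (LaurentSeries K) g ∧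
        PowerSeries.constantCoeff g = ℓ (MvPolynomial.monomial d 1) by
      obtain ⟨g, hg₁, hg₂⟩ := hs
      refine ⟨PowerSeries.C a * g, ?_, ?_⟩
      · change _ = algebraMap (PowerSeries K) (LaurentSeries K) _
        rw [map_mul, ← hg₁, Finset.mul_sum]
        refine Finset.sum_congr rfl fun m _ => ?_
        change _ * algebraMap (PowerSeries K) (LaurentSeries K) _ = _
        rw [MvPolynomial.aeval_monomial, Finsupp.prod_fintype _ _ (by simp), map_mul,
          mul_left_comm]
        rfl
      · rw [map_mul, hg₂, PowerSeries.constantCoeff_C, ← smul_eq_mul, ← map_smul,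
          MvPolynomial.smul_monomial, smul_eq_mul, mul_one]
    rw [hmon]
    rcases le_or_gt d.degree 3 with hd | hd
    · obtain ⟨i, j, k, hi, hijk⟩ := exists_eq_mul_cons_of_degree_le (K := K) d hd
      obtain ⟨G, hG₁, hG₂, hG₃⟩ := h i j k
      have hM : ∑ m, c m * ∏ i, q m i.succ ^ d i = algebraMap _ (LaurentSeries K) G := by
        refine Eq.trans (Finset.sum_congr rfl fun m _ => ?_) hG₁
        have hcons : ∀ i, MvPolynomial.aeval (fun i : Fin n => q m i.succ)
            ((Fin.cons 1 MvPolynomial.X : Fin (n + 1) → MvPolynomial (Fin n) K) i) = q m i := by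
          intro i
          refine Fin.cases ?_ (fun i => ?_) i
          · simp [hq]
          · simp
        have := congrArg (MvPolynomial.aeval (fun i : Fin n => q m i.succ)) hijk
        simp only [map_mul, hcons, MvPolynomial.aeval_monomial, map_one, one_mul] at this
        rw [Finsupp.prod_fintype _ _ (by simp)] at this
        rw [this]
        ring
      rw [hM, hijk]
      rcases hd.lt_or_eq with hd' | hd'
      · refine ⟨0, ?_, ?_⟩
        · rw [hG₃ (hi hd')]
          simp
        · rw [← hG₂, hG₃ (hi hd')]
      · refine ⟨G, ?_, hG₂⟩
        rw [hd', mul_comm N 3, inv_mul_cancel₀ (pow_ne_zero _ hT), one_mul]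
    · rw [hℓ d (by omega)]
      obtain ⟨D, hD⟩ := Nat.exists_eq_add_of_lt hd
      have hS : T ^ (v * (d.degree + 1)) * ∑ m, c m * ∏ i, q m i.succ ^ d i =
          algebraMap _ (LaurentSeries K)
            (∑ m, g (Sum.inl m) * ∏ i, g (Sum.inr (m, i)) ^ d i) := by
        rw [map_sum, Finset.mul_sum]
        refine Finset.sum_congr rfl fun m _ => ?_
        simp only [map_mul, map_prod, map_pow, ← hg, Sum.elim_inl, Sum.elim_inr, mul_pow,
          Finset.prod_mul_distrib, ← pow_mul, Finset.prod_pow_eq_pow_sum, ← Finset.mul_sum,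
          Finsupp.degree_eq_sum]
        ring
      refine ⟨PowerSeries.X ^ (4 * v * D + D + 1) *
        ∑ m, g (Sum.inl m) * ∏ i, g (Sum.inr (m, i)) ^ d i, ?_, by simp⟩
      rw [map_mul, ← hS, map_pow]
      change _ = T ^ _ * _
      rw [mul_assoc, inv_mul_eq_iff_eq_mul₀ (pow_ne_zero _ hT), ← mul_assoc, ← mul_assoc,
        ← pow_add, ← pow_add]
      congr 2
      simp only [hD, N]
      ring

/-- The quotient by `T` of a finite free algebra over power series has dimension at most the
rank. -/
lemma finrank_quotient_X_le {K B : Type} [Field K] [CommRing B] [Algebra (PowerSeries K) B]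
    [Algebra K B] [IsScalarTower K (PowerSeries K) B] [Module.Free (PowerSeries K) B]
    [Module.Finite (PowerSeries K) B] :
    Module.Finite K (B ⧸ Ideal.span {algebraMap (PowerSeries K) B PowerSeries.X}) ∧
      Module.finrank K (B ⧸ Ideal.span {algebraMap (PowerSeries K) B PowerSeries.X}) ≤
        Module.finrank (PowerSeries K) B := by
  let b := Module.finBasis (PowerSeries K) B
  let v : Fin (Module.finrank (PowerSeries K) B) →
      B ⧸ Ideal.span {algebraMap (PowerSeries K) B PowerSeries.X} := fun i => Ideal.Quotient.mk _ (b i)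
  have hmod : ∀ (a : PowerSeries K) (x : B),
      Ideal.Quotient.mk (Ideal.span {algebraMap (PowerSeries K) B PowerSeries.X}) (a • x) =
        PowerSeries.constantCoeff a • Ideal.Quotient.mk _ x := by
    intro a x
    rw [← Ideal.Quotient.mkₐ_eq_mk K, ← map_smul, Ideal.Quotient.mkₐ_eq_mk, Ideal.Quotient.eq,
      Ideal.mem_span_singleton]
    obtain ⟨a', ha'⟩ : PowerSeries.X ∣ a - PowerSeries.C (PowerSeries.constantCoeff a) := by
      rw [PowerSeries.X_dvd_iff]
      simp
    refine ⟨a' • x, ?_⟩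
    rw [← algebraMap_smul (PowerSeries K) (PowerSeries.constantCoeff a) x, ← sub_smul,
      mul_smul_comm, ← Algebra.smul_def, smul_smul, mul_comm a', ← ha']
    rfl
  have hv : Submodule.span K (Set.range v) = ⊤ := by
    rw [eq_top_iff]
    rintro x -
    obtain ⟨x, rfl⟩ := Ideal.Quotient.mk_surjective x
    rw [← b.sum_repr x, map_sum]
    refine Submodule.sum_mem _ fun i _ => ?_
    rw [hmod]
    exact Submodule.smul_mem _ _ (Submodule.subset_span ⟨i, rfl⟩)
  classical
  refine ⟨⟨⟨Finset.univ.image v, by simpa using hv⟩⟩, ?_⟩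
  simpa using finrank_le_of_span_eq_top hv

open TensorProduct in
/-- A full-rank subalgebra of a product of copies of `K⟦T⟧` is generically étale. -/
lemma etale_laurentSeries_tensorProduct {K ι : Type} [Field K] [Fintype ι]
    (B : Subalgebra (PowerSeries K) (ι → PowerSeries K)) [Module.Free (PowerSeries K) B]
    [Module.Finite (PowerSeries K) B]
    (hB : Module.finrank (PowerSeries K) B = Fintype.card ι) :
    Algebra.Etale (LaurentSeries K) (LaurentSeries K ⊗[PowerSeries K] B) := by
  let F : LaurentSeries K ⊗[PowerSeries K] B →ₐ[LaurentSeries K]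
      LaurentSeries K ⊗[PowerSeries K] (ι → PowerSeries K) :=
    Algebra.TensorProduct.map (AlgHom.id (LaurentSeries K) (LaurentSeries K)) B.val
  have hF : Function.Injective F :=
    Module.Flat.lTensor_preserves_injective_linearMap (M := LaurentSeries K) B.val.toLinearMap
      Subtype.val_injective
  have hdim : Module.finrank (LaurentSeries K) (LaurentSeries K ⊗[PowerSeries K] B) =
      Module.finrank (LaurentSeries K) (LaurentSeries K ⊗[PowerSeries K] (ι → PowerSeries K)) := by
    rw [Module.finrank_baseChange, Module.finrank_baseChange, hB, Module.finrank_pi]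
  have hbij : Function.Bijective F :=
    ⟨hF, (LinearMap.injective_iff_surjective_of_finrank_eq_finrank hdim (f := F.toLinearMap)).1 hF⟩
  exact Algebra.Etale.of_equiv (AlgEquiv.ofBijective F hbij).symm

/-- A quotient `R ⧸ I` whose ideal contains the radical of a functional `ℓ` is smoothable as soon
as `ℓ` is a limit of functionals supported on `dim (R ⧸ I)` points. -/
lemma isSmoothable_of_points {K ι : Type} [Field K] [Fintype ι] {n : ℕ}
    (I : Ideal (MvPolynomial (Fin n) K)) (ℓ : MvPolynomial (Fin n) K →ₗ[K] K)
    (hI : ∀ f, (∀ r, ℓ (f * r) = 0) → f ∈ I)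
    (hdim : Module.Finite K (MvPolynomial (Fin n) K ⧸ I) →
      Fintype.card ι ≤ Module.finrank K (MvPolynomial (Fin n) K ⧸ I))
    (P : ι → Fin n → PowerSeries K) (c : ι → LaurentSeries K)
    (h : ∀ f : MvPolynomial (Fin n) K, ∃ g : PowerSeries K,
        ∑ m, c m * (MvPolynomial.aeval (P m) f : PowerSeries K) = (g : LaurentSeries K) ∧
        PowerSeries.constantCoeff g = ℓ f) :
    IsSmoothable K (MvPolynomial (Fin n) K ⧸ I) (Fintype.card ι) := by
  let ev : MvPolynomial (Fin n) (PowerSeries K) →ₐ[PowerSeries K] (ι → PowerSeries K) :=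
    MvPolynomial.aeval fun i m => P m i
  let B := ev.range
  have hfree : Module.Free (PowerSeries K) B :=
    inferInstanceAs (Module.Free (PowerSeries K) (Subalgebra.toSubmodule B))
  have hfin : Module.Finite (PowerSeries K) B :=
    inferInstanceAs (Module.Finite (PowerSeries K) (Subalgebra.toSubmodule B))
  have hrank : Module.finrank (PowerSeries K) B ≤ Fintype.card ι := by
    rw [← Module.finrank_pi (PowerSeries K)]
    exact Submodule.finrank_le (Subalgebra.toSubmodule B)
  let J : Ideal B := Ideal.span {algebraMap (PowerSeries K) B PowerSeries.X}
  obtain ⟨hqfin, hqrank⟩ : Module.Finite K (B ⧸ J) ∧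
      Module.finrank K (B ⧸ J) ≤ Module.finrank (PowerSeries K) B := finrank_quotient_X_le
  let x : Fin n → B := fun i => ⟨fun m => P m i, MvPolynomial.X i, by simp [ev]⟩
  let α : MvPolynomial (Fin n) K →ₐ[K] B ⧸ J :=
    (Ideal.Quotient.mkₐ K J).comp (MvPolynomial.aeval x)
  have hα : Function.Surjective α := by
    intro b
    obtain ⟨⟨_, y, rfl⟩, rfl⟩ := Ideal.Quotient.mk_surjective b
    change Ideal.Quotient.mkₐ K J (ev.rangeRestrict y) ∈ α.range
    induction y using MvPolynomial.induction_on with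
    | C a =>
      refine ⟨MvPolynomial.C (PowerSeries.constantCoeff a), ?_⟩
      obtain ⟨a', ha'⟩ : PowerSeries.X ∣ PowerSeries.C (PowerSeries.constantCoeff a) - a := by
        rw [PowerSeries.X_dvd_iff]
        simp
      change Ideal.Quotient.mk J (MvPolynomial.aeval x _) = Ideal.Quotient.mk J _
      rw [Ideal.Quotient.eq, Ideal.mem_span_singleton]
      refine ⟨algebraMap _ B a', ?_⟩
      rw [← map_mul, ← ha', map_sub]
      congr 1
      · rw [MvPolynomial.aeval_C, IsScalarTower.algebraMap_apply K (PowerSeries K) B]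
        rfl
      · exact ev.rangeRestrict.commutes a
    | add y₁ y₂ h₁ h₂ =>
      rw [map_add, map_add]
      exact add_mem h₁ h₂
    | mul_X y i hy =>
      rw [map_mul, map_mul]
      refine mul_mem hy ⟨MvPolynomial.X i, ?_⟩
      change Ideal.Quotient.mk J (MvPolynomial.aeval x _) = Ideal.Quotient.mk J _
      rw [MvPolynomial.aeval_X]
      congr 1
      exact Subtype.ext (MvPolynomial.aeval_X (fun i m => P m i) i).symm
  have hint : ∀ y, ∃ g : PowerSeries K,
      ∑ m, c m * (ev y m : LaurentSeries K) = (g : LaurentSeries K) := by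
    intro y
    induction y using MvPolynomial.induction_on' with
    | monomial d a =>
      obtain ⟨g, hg, -⟩ := h (MvPolynomial.monomial d 1)
      refine ⟨a * g, ?_⟩
      change _ = algebraMap (PowerSeries K) (LaurentSeries K) _
      rw [map_mul]
      change _ = _ * (g : LaurentSeries K)
      rw [← hg, Finset.mul_sum]
      refine Finset.sum_congr rfl fun m _ => ?_
      have : ev (MvPolynomial.monomial d a) m = a * MvPolynomial.aeval (P m)
          (MvPolynomial.monomial d (1 : K)) := by
        simp [ev, MvPolynomial.aeval_monomial, Finsupp.prod_fintype]
      change c m * algebraMap (PowerSeries K) (LaurentSeries K)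
        (ev (MvPolynomial.monomial d a) m) = _
      rw [this, map_mul, mul_left_comm]
      rfl
    | add y₁ y₂ h₁ h₂ =>
      obtain ⟨g₁, h₁⟩ := h₁
      obtain ⟨g₂, h₂⟩ := h₂
      refine ⟨g₁ + g₂, ?_⟩
      change _ = algebraMap (PowerSeries K) (LaurentSeries K) _
      rw [map_add (algebraMap (PowerSeries K) (LaurentSeries K))]
      refine Eq.trans ?_ (congrArg₂ (· + ·) h₁ h₂)
      rw [← Finset.sum_add_distrib]
      refine Finset.sum_congr rfl fun m _ => ?_
      change _ * algebraMap (PowerSeries K) (LaurentSeries K) (ev (y₁ + y₂) m) = _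
      rw [map_add, Pi.add_apply, map_add, mul_add]
      rfl
  have hx : ∀ (f : MvPolynomial (Fin n) K) m, (MvPolynomial.aeval x f : B).1 m =
      MvPolynomial.aeval (P m) f := by
    intro f m
    have : ((Pi.evalAlgHom (PowerSeries K) (fun _ : ι => PowerSeries K) m).restrictScalars K).comp
        ((B.val.restrictScalars K).comp (MvPolynomial.aeval x)) = MvPolynomial.aeval (P m) := by
      ext i : 1
      simp [x]
    exact AlgHom.congr_fun this f
  have hker : RingHom.ker α ≤ I := by
    intro f hf
    refine hI f fun r => ?_
    have hmem : (MvPolynomial.aeval x f : B) ∈ J := Ideal.Quotient.eq_zero_iff_mem.1 hf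
    have hmem' : (MvPolynomial.aeval x (f * r) : B) ∈ J := by
      rw [map_mul]
      exact J.mul_mem_right _ hmem
    obtain ⟨⟨_, y, rfl⟩, hb⟩ := Ideal.mem_span_singleton.1 hmem'
    obtain ⟨g', hg'⟩ := hint y
    obtain ⟨g, hg, hgℓ⟩ := h (f * r)
    have hgg : g = PowerSeries.X * g' := by
      apply IsFractionRing.injective (PowerSeries K) (LaurentSeries K)
      rw [map_mul]
      refine hg.symm.trans (Eq.trans ?_ (congrArg (algebraMap (PowerSeries K) (LaurentSeries K)
        PowerSeries.X * ·) hg'))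
      rw [Finset.mul_sum]
      refine Finset.sum_congr rfl fun m _ => ?_
      rw [← hx, hb, mul_left_comm]
      congr 1
      exact map_mul (algebraMap (PowerSeries K) (LaurentSeries K)) _ _
    rw [← hgℓ, hgg]
    simp
  have hfinA : Module.Finite K (MvPolynomial (Fin n) K ⧸ RingHom.ker α) :=
    Module.Finite.equiv (Ideal.quotientKerAlgEquivOfSurjective hα).symm.toLinearEquiv
  have hdimα : Module.finrank K (MvPolynomial (Fin n) K ⧸ RingHom.ker α) =
      Module.finrank K (B ⧸ J) :=
    (Ideal.quotientKerAlgEquivOfSurjective hα).toLinearEquiv.finrank_eq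
  let β : (MvPolynomial (Fin n) K ⧸ RingHom.ker α) →ₐ[K] MvPolynomial (Fin n) K ⧸ I :=
    Ideal.Quotient.factorₐ K hker
  have hβ : Function.Surjective β := Ideal.Quotient.factor_surjective hker
  have hfinI : Module.Finite K (MvPolynomial (Fin n) K ⧸ I) :=
    Module.Finite.of_surjective β.toLinearMap hβ
  have hle := LinearMap.finrank_le_finrank_of_surjective (f := β.toLinearMap) hβ
  have hd := hdim hfinI
  have hcard : Module.finrank (PowerSeries K) B = Fintype.card ι := by omega
  have hbij : Function.Bijective β :=
    ⟨(LinearMap.injective_iff_surjective_of_finrank_eq_finrank (f := β.toLinearMap)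
      (by omega)).2 hβ, hβ⟩
  exact ⟨B, inferInstance, inferInstance, inferInstance, inferInstance, hfree, hcard,
    ⟨(Ideal.quotientKerAlgEquivOfSurjective hα).symm.trans (AlgEquiv.ofBijective β hbij)⟩,
    etale_laurentSeries_tensorProduct B hcard⟩

lemma mk_mem_gradedPiece {K : Type} [Field K] {n : ℕ} (I : Ideal (MvPolynomial (Fin n) K)) {t : ℕ}
    {f : MvPolynomial (Fin n) K} (hf : f.IsHomogeneous t) :
    Ideal.Quotient.mk I f ∈ gradedPiece K n I t :=
  ⟨f, hf, rfl⟩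

lemma finite_gradedPiece {K : Type} [Field K] {n : ℕ} (I : Ideal (MvPolynomial (Fin n) K))
    (t : ℕ) : Module.Finite K (gradedPiece K n I t) :=
  Module.Finite.of_fg ((MvPolynomial.homogeneousSubmodule_fg (Fin n) K t).map _)

lemma mem_of_isHomogeneous_of_finrank_eq_zero {K : Type} [Field K] {n : ℕ}
    (I : Ideal (MvPolynomial (Fin n) K)) {t : ℕ} (h : Module.finrank K (gradedPiece K n I t) = 0)
    {f : MvPolynomial (Fin n) K} (hf : f.IsHomogeneous t) : f ∈ I := by
  have := finite_gradedPiece I t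
  rw [Submodule.finrank_eq_zero] at h
  have := mk_mem_gradedPiece I hf
  rwa [h, Submodule.mem_bot, Ideal.Quotient.eq_zero_iff_mem] at this

open MvPolynomial in
/-- The linear map taking a polynomial to the class of its component of degree `t`. -/
noncomputable def gradedPieceComponent (K : Type) [Field K] (n : ℕ)
    (I : Ideal (MvPolynomial (Fin n) K)) (t : ℕ) :
    MvPolynomial (Fin n) K →ₗ[K] gradedPiece K n I t :=
  LinearMap.codRestrict _ ((Ideal.Quotient.mkₐ K I).toLinearMap ∘ₗ homogeneousComponent t)
    fun f => mk_mem_gradedPiece I (homogeneousComponent_isHomogeneous t f)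

lemma coe_gradedPieceComponent {K : Type} [Field K] {n : ℕ} (I : Ideal (MvPolynomial (Fin n) K))
    (t : ℕ) (f : MvPolynomial (Fin n) K) :
    (gradedPieceComponent K n I t f : MvPolynomial (Fin n) K ⧸ I) =
      Ideal.Quotient.mk I (MvPolynomial.homogeneousComponent t f) := rfl

lemma gradedPieceComponent_eq_zero_iff {K : Type} [Field K] {n : ℕ}
    (I : Ideal (MvPolynomial (Fin n) K)) (t : ℕ) (f : MvPolynomial (Fin n) K) :
    gradedPieceComponent K n I t f = 0 ↔ MvPolynomial.homogeneousComponent t f ∈ I := by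
  rw [← Submodule.coe_eq_zero, coe_gradedPieceComponent, Ideal.Quotient.eq_zero_iff_mem]

open MvPolynomial in
/-- The Hilbert function bounds the dimension of a graded quotient from below. -/
lemma sum_finrank_gradedPiece_le {K : Type} [Field K] {n : ℕ}
    (I : Ideal (MvPolynomial (Fin n) K)) (hhom : ∀ f ∈ I, ∀ d, homogeneousComponent d f ∈ I)
    [Module.Finite K (MvPolynomial (Fin n) K ⧸ I)] (N : ℕ) :
    ∑ t : Fin N, Module.finrank K (gradedPiece K n I t) ≤
      Module.finrank K (MvPolynomial (Fin n) K ⧸ I) := by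
  have (t : Fin N) : Module.Finite K (gradedPiece K n I t) := finite_gradedPiece I t
  let F : MvPolynomial (Fin n) K →ₗ[K] (∀ t : Fin N, gradedPiece K n I t) :=
    LinearMap.pi fun t => gradedPieceComponent K n I t
  have hF : I.restrictScalars K ≤ LinearMap.ker F := by
    intro f hf
    rw [LinearMap.mem_ker]
    ext1 t
    exact (gradedPieceComponent_eq_zero_iff I t f).2 (hhom f hf t)
  let G : (MvPolynomial (Fin n) K ⧸ I) →ₗ[K] (∀ t : Fin N, gradedPiece K n I t) :=
    Submodule.liftQ (I.restrictScalars K) F hF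
  rw [← Module.finrank_pi_fintype]
  refine LinearMap.finrank_le_finrank_of_surjective (f := G) fun y => ?_
  choose f hf hfy using fun t => (y t).2
  refine ⟨Ideal.Quotient.mk I (∑ t, f t), ?_⟩
  change F (∑ t, f t) = y
  ext t
  change (gradedPieceComponent K n I t (∑ t, f t) : MvPolynomial (Fin n) K ⧸ I) = y t
  rw [coe_gradedPieceComponent, map_sum, Finset.sum_eq_single t, ← hfy t]
  · rw [homogeneousComponent_of_mem (hf t), if_pos rfl]
    rfl
  · intro s _ hs
    rw [homogeneousComponent_of_mem (hf s), if_neg (fun h => hs (Fin.ext h.symm))]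
  · simp

open MvPolynomial in
/-- A graded Gorenstein quotient with socle in degree `s` is determined by a functional supported
in degree `s`. -/
lemma exists_dual_functional {K : Type} [Field K] {n : ℕ} (I : Ideal (MvPolynomial (Fin n) K))
    (s : ℕ) (hhom : ∀ f ∈ I, ∀ d, homogeneousComponent d f ∈ I)
    (hs : Module.finrank K (gradedPiece K n I s) = 1)
    (hgt : ∀ t, s < t → Module.finrank K (gradedPiece K n I t) = 0)
    (hsoc : Module.finrank K (socle K n I) = 1) :
    ∃ ℓ : MvPolynomial (Fin n) K →ₗ[K] K, (∀ d, d.degree ≠ s → ℓ (monomial d 1) = 0) ∧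
      ∀ f, (∀ r, ℓ (f * r) = 0) → f ∈ I := by
  have hmem : ∀ t, s < t → ∀ f : MvPolynomial (Fin n) K, f.IsHomogeneous t → f ∈ I :=
    fun t ht f hf => mem_of_isHomogeneous_of_finrank_eq_zero I (hgt t ht) hf
  have : Module.Finite K (gradedPiece K n I s) := finite_gradedPiece I s
  have : Module.Finite K (socle K n I) := Module.finite_of_finrank_pos (by omega)
  have hle : gradedPiece K n I s ≤ socle K n I := by
    rintro _ ⟨f, hf, rfl⟩
    rw [socle, Submodule.mem_iInf]
    intro i
    change Ideal.Quotient.mk I f * Ideal.Quotient.mk I (X i) = 0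
    rw [← map_mul, Ideal.Quotient.eq_zero_iff_mem]
    exact hmem (s + 1) (by omega) _ (IsHomogeneous.mul hf (isHomogeneous_X K i))
  have hsoc' : gradedPiece K n I s = socle K n I :=
    Submodule.eq_of_le_of_finrank_eq hle (by rw [hs, hsoc])
  let e : gradedPiece K n I s ≃ₗ[K] K :=
    LinearEquiv.ofFinrankEq _ _ (by rw [hs, Module.finrank_self])
  refine ⟨e.toLinearMap ∘ₗ gradedPieceComponent K n I s, ?_, ?_⟩
  · intro d hd
    rw [LinearMap.comp_apply, (gradedPieceComponent_eq_zero_iff I s _).2, map_zero]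
    rw [homogeneousComponent_of_mem (isHomogeneous_monomial (1 : K) rfl), if_neg hd.symm]
    exact I.zero_mem
  · intro f hf
    by_contra hfI
    let P : ℕ → Prop := fun k => ∃ r : MvPolynomial (Fin n) K, r.IsHomogeneous k ∧ f * r ∉ I
    have hP0 : P 0 := ⟨1, isHomogeneous_one _ _, by rwa [mul_one]⟩
    have hPs : ∀ k, P k → k ≤ s := by
      rintro k ⟨r, hr, hfr⟩
      by_contra hk
      refine hfr ?_
      exact I.mul_mem_left _ (hmem k (by omega) r hr)
    obtain ⟨k, ⟨r, hr, hfr⟩, hmax⟩ : ∃ k, P k ∧ ¬ P (k + 1) := by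
      by_contra! h
      have : ∀ k, P k := fun k => Nat.rec hP0 (fun k hk => h k hk) k
      have := hPs _ (this (s + 1))
      omega
    have hmk : Ideal.Quotient.mk I (f * r) ∈ gradedPiece K n I s := by
      rw [hsoc', socle, Submodule.mem_iInf]
      intro i
      change Ideal.Quotient.mk I (f * r) * Ideal.Quotient.mk I (X i) = 0
      rw [← map_mul, Ideal.Quotient.eq_zero_iff_mem]
      by_contra hi
      exact hmax ⟨r * X i, hr.mul (isHomogeneous_X K i), by rwa [← mul_assoc]⟩
    obtain ⟨h, hh, hhr⟩ := hmk
    have hsub : f * r - h ∈ I := Ideal.Quotient.eq.1 hhr.symm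
    have h0 := hhom _ hsub s
    rw [map_sub, homogeneousComponent_of_mem hh, if_pos rfl] at h0
    have h1 : homogeneousComponent s (f * r) ∈ I := by
      rw [← gradedPieceComponent_eq_zero_iff]
      exact e.map_eq_zero_iff.1 (hf r)
    refine hfr ?_
    simpa using I.add_mem hsub (I.sub_mem h1 h0)

/-- Over an algebraically closed field `K` of characteristic `0`, every graded Gorenstein
quotient of `K[x₁,…,x₅]` with Hilbert function `(1,5,5,1)` is smoothable (with `d = 12`). -/
theorem gorenstein_1551_smoothable (K : Type) [Field K] [IsAlgClosed K] [CharZero K]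
    (I : Ideal (MvPolynomial (Fin 5) K))
    (hhom : ∀ f ∈ I, ∀ d : ℕ, MvPolynomial.homogeneousComponent d f ∈ I)
    (h0 : Module.finrank K (gradedPiece K 5 I 0) = 1)
    (h1 : Module.finrank K (gradedPiece K 5 I 1) = 5)
    (h2 : Module.finrank K (gradedPiece K 5 I 2) = 5)
    (h3 : Module.finrank K (gradedPiece K 5 I 3) = 1)
    (hge : ∀ t : ℕ, 4 ≤ t → Module.finrank K (gradedPiece K 5 I t) = 0)
    (hgor : Module.finrank K (socle K 5 I) = 1) :
    IsSmoothable K (MvPolynomial (Fin 5) K ⧸ I) 12 := by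
  obtain ⟨ℓ, hℓ, hI⟩ := exists_dual_functional I 3 hhom h3 (fun t ht => hge t ht) hgor
  obtain ⟨c, q, hq, h⟩ := exists_laurentSeries_moments
    (fun i j k => ℓ ((Fin.cons 1 MvPolynomial.X : Fin 6 → _) i *
      (Fin.cons 1 MvPolynomial.X : Fin 6 → _) j * (Fin.cons 1 MvPolynomial.X : Fin 6 → _) k))
    (fun i j k => by ring_nf) (fun i j k => by ring_nf) fun j k => by
      obtain ⟨d, hd, hdj⟩ := cons_one_X_eq_monomial (K := K) j
      obtain ⟨e, he, hek⟩ := cons_one_X_eq_monomial (K := K) k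
      rw [hdj, hek, Fin.cons_zero, one_mul, MvPolynomial.monomial_mul, one_mul]
      refine hℓ _ ?_
      rw [map_add]
      omega
  obtain ⟨P, c', hP⟩ := exists_points_of_cubic_moments ℓ hℓ c q hq h
  refine isSmoothable_of_points (ι := Fin 6 ⊕ Fin 6) I ℓ hI (fun _ => ?_) P c' hP
  have := sum_finrank_gradedPiece_le I hhom 4
  simp only [Fin.sum_univ_four, Fin.isValue, Fin.coe_ofNat_eq_mod] at this
  norm_num [h0, h1, h2, h3] at this
  simpa using this
end

section
/- Let K be an algebraically closed field of characteristic 0, and let A be a local Artinian Gorenstein K-algebra with residue field K and Hilbert function (1,5,5,1). Then A is smoothable (with d = 12). -/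
/-- The `K`-dimension of `mⁱ/mⁱ⁺¹`, where `m` is the maximal ideal of the local ring `A`. -/
noncomputable def assocGradedDim (K A : Type) [Field K] [CommRing A] [Algebra K A]
    [IsLocalRing A] (i : ℕ) : ℕ :=
  Module.finrank K
    (((IsLocalRing.maximalIdeal A ^ i).restrictScalars K) ⧸
      (Submodule.comap ((IsLocalRing.maximalIdeal A ^ i).restrictScalars K).subtype
        ((IsLocalRing.maximalIdeal A ^ (i + 1)).restrictScalars K)))

/-- The symmetric conference matrix of order six. -/
def conf : Matrix (Fin 6) (Fin 6) ℤ :=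
  !![0, 1, 1, 1, 1, 1; 1, 0, 1, -1, -1, 1; 1, 1, 0, 1, -1, -1;
     1, -1, 1, 0, 1, -1; 1, -1, -1, 1, 0, 1; 1, 1, -1, -1, 1, 0]

/-- Coefficients of a right inverse (up to the factor `36`) of the map sending `η` to the
squarefree part of the cubic `∑ⱼ oⱼ² ηⱼ`, where `oⱼ` are the rows of `conf`. -/
def confInv (j k a b d : Fin 6) : ℤ :=
  if k = a then 3 * (conf j b * conf j d)
  else if k = b then 3 * (conf j a * conf j d)
  else if k = d then 3 * (conf j a * conf j b)
  else (∑ m, conf m a * conf m b * conf m d * conf m k) / 2 *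
    (if j = a ∨ j = b ∨ j = d ∨ j = k then 1 else -2)

set_option maxRecDepth 100000 in
theorem confInv_spec : ∀ a b d : Fin 6, a < b → b < d → ∀ a' b' d' : Fin 6, a' < b' → b' < d' →
    ∑ j, (conf j a * conf j b * confInv j d a' b' d' + conf j a * conf j d * confInv j b a' b' d'
      + conf j b * conf j d * confInv j a a' b' d')
      = if a = a' then if b = b' then if d = d' then 36 else 0 else 0 else 0 := by
  decide +kernel

/-- A function of three arguments invariant under all permutations of them. -/
def SymmTensor {n : Type*} {R : Type*} (T : n → n → n → R) : Prop :=
  (∀ a b d, T a b d = T b a d) ∧ ∀ a b d, T a b d = T a d b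

theorem SymmTensor.ext_of_le {n R : Type*} [LinearOrder n] {S T : n → n → n → R}
    (hS : SymmTensor S) (hT : SymmTensor T)
    (h : ∀ a b d, a ≤ b → b ≤ d → S a b d = T a b d) (a b d : n) : S a b d = T a b d := by
  obtain ⟨s1, s2⟩ := hS
  obtain ⟨t1, t2⟩ := hT
  rcases le_total a b with h1 | h1 <;> rcases le_total b d with h2 | h2 <;>
    rcases le_total a d with h3 | h3
  · exact h a b d h1 h2
  · exact h a b d h1 h2
  · rw [s2, t2]; exact h a d b h3 h2
  · rw [s2, t2, s1, t1]; exact h d a b h3 h1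
  · rw [s1, t1]; exact h b a d h1 h3
  · rw [s1, t1, s2, t2]; exact h b d a h2 h3
  · rw [s1, t1, s2, t2, s1, t1]; exact h d b a h2 h1
  · rw [s1, t1, s2, t2, s1, t1]; exact h d b a h2 h1

/-- The cubic tensor `∑ᵢ cᵢ Xᵢ ⊗ Xᵢ ⊗ Xᵢ`. -/
def cubicSum {ι n R : Type*} [Fintype ι] [CommRing R] (c : ι → R) (X : ι → n → R)
    (a b d : n) : R :=
  ∑ i, c i * (X i a * X i b * X i d)

/-- The derivative of `cubicSum c` at `X` in the direction `δ`. -/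
def cubicSumDeriv {ι n R : Type*} [Fintype ι] [CommRing R] (c : ι → R) (X δ : ι → n → R)
    (a b d : n) : R :=
  ∑ i, c i * (X i a * X i b * δ i d + X i a * X i d * δ i b + X i b * X i d * δ i a)

theorem symmTensor_cubicSum {ι n R : Type*} [Fintype ι] [CommRing R] (c : ι → R)
    (X : ι → n → R) : SymmTensor (cubicSum c X) :=
  ⟨fun _ _ _ => Finset.sum_congr rfl fun _ _ => by ring,
    fun _ _ _ => Finset.sum_congr rfl fun _ _ => by ring⟩

theorem symmTensor_cubicSumDeriv {ι n R : Type*} [Fintype ι] [CommRing R] (c : ι → R)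
    (X δ : ι → n → R) : SymmTensor (cubicSumDeriv c X δ) :=
  ⟨fun _ _ _ => Finset.sum_congr rfl fun _ _ => by ring,
    fun _ _ _ => Finset.sum_congr rfl fun _ _ => by ring⟩

theorem exists_squarefree_preimage {K : Type*} [Field K] [CharZero K]
    (T : Fin 6 → Fin 6 → Fin 6 → K) :
    ∃ η : Fin 6 → Fin 6 → K, ∀ a b d, a < b → b < d →
      ∑ j, ((conf j a * conf j b : K) * η j d + conf j a * conf j d * η j b
        + conf j b * conf j d * η j a) = T a b d := by
  refine ⟨fun j k => ∑ t : Fin 6 × Fin 6 × Fin 6, if t.1 < t.2.1 ∧ t.2.1 < t.2.2 then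
    (confInv j k t.1 t.2.1 t.2.2 : K) * (T t.1 t.2.1 t.2.2 / 36) else 0, fun a b d hab hbd => ?_⟩
  simp only [Finset.mul_sum, ← Finset.sum_add_distrib]
  rw [Finset.sum_comm]
  rw [Finset.sum_eq_single (a, b, d)]
  · have h := congrArg (Int.cast : ℤ → K) (confInv_spec a b d hab hbd a b d hab hbd)
    push_cast at h
    simp only [hab, hbd, and_self, if_true] at h ⊢
    calc _ = (T a b d / 36) * 36 := by
          rw [← h, Finset.mul_sum]; exact Finset.sum_congr rfl fun _ _ => by ring
      _ = _ := by field_simp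
  · rintro ⟨a', b', d'⟩ - hne
    by_cases hlt : a' < b' ∧ b' < d'
    · have h := congrArg (Int.cast : ℤ → K) (confInv_spec a b d hab hbd a' b' d' hlt.1 hlt.2)
      have h0 :
          (if a = a' then if b = b' then if d = d' then (36 : ℤ) else 0 else 0 else 0) = 0 := by
        split_ifs with h1 h2 h3
        · subst h1 h2 h3; exact absurd rfl hne
        all_goals rfl
      rw [h0] at h
      push_cast at h
      simp only [hlt, and_self, if_true]
      calc _ = (T a' b' d' / 36) * 0 := by
            rw [← h, Finset.mul_sum]; exact Finset.sum_congr rfl fun _ _ => by ring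
        _ = _ := mul_zero _
    · simp [hlt]
  · simp

/-- Twelve vectors in `K⁶`: the standard basis and the rows of `conf`. -/
def basePoint (K : Type*) [Field K] : Fin 6 ⊕ Fin 6 → Fin 6 → K
  | .inl i => Pi.single i 1
  | .inr j => fun k => conf j k

/-- The weights of the points `basePoint`. -/
def baseWeight (K : Type*) [Field K] : Fin 6 ⊕ Fin 6 → K
  | .inl _ => 5
  | .inr j => -(∑ k, (conf j k : K))⁻¹

theorem conf_row_sum_ne_zero {K : Type*} [Field K] [CharZero K] (j : Fin 6) :
    (∑ k, (conf j k : K)) ≠ 0 := by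
  have h : ∀ j, ∑ k, conf j k ≠ 0 := by decide
  exact_mod_cast h j

theorem sum_basePoint_ne_zero {K : Type*} [Field K] [CharZero K] (i : Fin 6 ⊕ Fin 6) :
    ∑ a, basePoint K i a ≠ 0 := by
  rcases i with i | j
  · simp [basePoint]
  · exact conf_row_sum_ne_zero j

theorem sum_cubicSum_basePoint {K : Type*} [Field K] [CharZero K] (a b : Fin 6) :
    ∑ d, cubicSum (baseWeight K) (basePoint K) a b d = 0 := by
  have h : ∀ a b, (if a = b then 5 else 0) - ∑ j, conf j a * conf j b = 0 := by decide
  have h := congrArg (Int.cast : ℤ → K) (h a b)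
  push_cast at h
  unfold cubicSum
  rw [Finset.sum_comm]
  simp only [← Finset.mul_sum, Fintype.sum_sum_type]
  refine Eq.trans ?_ h
  rw [sub_eq_add_neg, ← Finset.sum_neg_distrib]
  congr 1
  · simp [basePoint, baseWeight, Pi.single_apply, eq_comm]
  · refine Finset.sum_congr rfl fun j _ => ?_
    have := conf_row_sum_ne_zero (K := K) j
    simp only [basePoint, baseWeight]
    field_simp

theorem sum_single_mul_single_mul {n R : Type*} [Fintype n] [DecidableEq n] [CommRing R]
    (a b : n) (f : n → R) :
    ∑ i, (Pi.single i 1 : n → R) a * (Pi.single i 1 : n → R) b * f i =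
      if a = b then f a else 0 := by
  rw [Finset.sum_eq_single a]
  · simp [Pi.single_apply, eq_comm]
  · intro i _ hi
    simp [Pi.single_apply, hi.symm]
  · simp

theorem exists_cubicSumDeriv_basePoint {K : Type*} [Field K] [CharZero K]
    {T : Fin 6 → Fin 6 → Fin 6 → K} (hT : SymmTensor T) :
    ∃ δ, cubicSumDeriv (baseWeight K) (basePoint K) δ = T := by
  obtain ⟨η, hη⟩ := exists_squarefree_preimage T
  set R : Fin 6 → Fin 6 → Fin 6 → K := fun a b d => ∑ j, ((conf j a * conf j b : K) * η j d
    + conf j a * conf j d * η j b + conf j b * conf j d * η j a) with hR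
  refine ⟨Sum.elim (fun i k => (T i i k - R i i k) / if i = k then 15 else 5)
    (fun j k => -(∑ k, (conf j k : K)) * η j k), ?_⟩
  funext a b d
  refine SymmTensor.ext_of_le (symmTensor_cubicSumDeriv _ _ _) hT (fun a b d hab hbd => ?_) a b d
  have key : cubicSumDeriv (baseWeight K) (basePoint K)
      (Sum.elim (fun i k => (T i i k - R i i k) / if i = k then 15 else 5)
        (fun j k => -(∑ k, (conf j k : K)) * η j k)) a b d =
      5 * ((if a = b then (T a a d - R a a d) / (if a = d then 15 else 5) else 0)
      + (if a = d then (T a a b - R a a b) / (if a = b then 15 else 5) else 0)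
      + (if b = d then (T b b a - R b b a) / (if b = a then 15 else 5) else 0)) + R a b d := by
    unfold cubicSumDeriv
    rw [Fintype.sum_sum_type]
    congr 1
    · simp only [basePoint, baseWeight, Sum.elim_inl, ← Finset.mul_sum, Finset.sum_add_distrib,
        sum_single_mul_single_mul]
    · refine Finset.sum_congr rfl fun j _ => ?_
      have := conf_row_sum_ne_zero (K := K) j
      simp only [basePoint, baseWeight, Sum.elim_inr]
      field_simp
      ring
  rw [key]
  obtain ⟨t1, t2⟩ := hT
  rcases hab.lt_or_eq with h1 | rfl <;> rcases hbd.lt_or_eq with h2 | rfl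
  · rw [if_neg h1.ne, if_neg h2.ne, if_neg (h1.trans h2).ne, ← hη a b d h1 h2]
    simp [hR]
  · have e : R a b b = R b b a := by
      simp only [hR]; exact Finset.sum_congr rfl fun _ _ => by ring
    rw [if_neg h1.ne, if_pos rfl, if_neg h1.ne', e, t2 b b a, t1 b a b]
    field_simp; ring
  · simp only [if_true, if_neg h2.ne]
    field_simp; ring
  · simp only [if_true]
    field_simp; ring

theorem cubicSum_add_mul {ι n R : Type*} [Fintype ι] [CommRing R] (c : ι → R)
    (X δ : ι → n → R) (t : R) (a b d : n) :
    ∃ r, cubicSum c (fun i k => X i k + t * δ i k) a b d =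
      cubicSum c X a b d + t * cubicSumDeriv c X δ a b d + t ^ 2 * r := by
  refine ⟨∑ i, c i * (X i a * δ i b * δ i d + δ i a * X i b * δ i d + δ i a * δ i b * X i d
    + t * (δ i a * δ i b * δ i d)), ?_⟩
  simp only [cubicSum, cubicSumDeriv, Finset.mul_sum, ← Finset.sum_add_distrib]
  exact Finset.sum_congr rfl fun i _ => by ring

theorem map_cubicSumDeriv {ι n R S : Type*} [Fintype ι] [CommRing R] [CommRing S] (f : R →+* S)
    (c : ι → R) (X δ : ι → n → R) (a b d : n) :
    f (cubicSumDeriv c X δ a b d) =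
      cubicSumDeriv (fun i => f (c i)) (fun i k => f (X i k)) (fun i k => f (δ i k)) a b d := by
  simp [cubicSumDeriv]

theorem map_cubicSum {ι n R S : Type*} [Fintype ι] [CommRing R] [CommRing S] (f : R →+* S)
    (c : ι → R) (X : ι → n → R) (a b d : n) :
    f (cubicSum c X a b d) = cubicSum (fun i => f (c i)) (fun i k => f (X i k)) a b d := by
  simp [cubicSum]

theorem PowerSeries.eq_zero_of_forall_X_pow_dvd {R : Type*} [CommRing R] {f : PowerSeries R}
    (h : ∀ n, (PowerSeries.X : PowerSeries R) ^ (n + 1) ∣ f) : f = 0 := by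
  ext k
  simpa using PowerSeries.X_pow_dvd_iff.1 (h k) k (Nat.lt_succ_self k)

section Newton

variable {K ι n : Type*} [Field K] [Fintype ι] (c : ι → K) (p : ι → n → K)
  (H : n → n → n → K)

/-- The failure of a family `Z` of vectors of power series to be a decomposition
of the tensor `∑ᵢ cᵢ pᵢ ⊗ pᵢ ⊗ pᵢ + t H`. -/
noncomputable def cubicError (Z : ι → n → PowerSeries K) (a b d : n) : PowerSeries K :=
  cubicSum (fun i => PowerSeries.C (c i)) Z a b d -
    (PowerSeries.C (cubicSum c p a b d) + PowerSeries.X * PowerSeries.C (H a b d))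

variable {c p H}

theorem exists_newton_step
    (hsurj : ∀ T : n → n → n → K, SymmTensor T → ∃ δ, cubicSumDeriv c p δ = T)
    (hH : SymmTensor H) (m : ℕ) (Z : ι → n → PowerSeries K)
    (hZ : ∀ i a, PowerSeries.constantCoeff (Z i a) = p i a)
    (hm : ∀ a b d, PowerSeries.X ^ (m + 1) ∣ cubicError c p H Z a b d) :
    ∃ Z' : ι → n → PowerSeries K, (∀ i a, PowerSeries.constantCoeff (Z' i a) = p i a) ∧
      (∀ a b d, PowerSeries.X ^ (m + 2) ∣ cubicError c p H Z' a b d) ∧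
      ∀ i a, PowerSeries.X ^ (m + 1) ∣ Z' i a - Z i a := by
  choose e he using hm
  have hcoeff : ∀ a b d, PowerSeries.constantCoeff (e a b d) =
      PowerSeries.coeff (m + 1) (cubicError c p H Z a b d) := by
    intro a b d
    rw [he, PowerSeries.coeff_X_pow_mul', if_pos le_rfl, Nat.sub_self,
      PowerSeries.coeff_zero_eq_constantCoeff_apply]
  have hsymm : SymmTensor (fun a b d => -PowerSeries.constantCoeff (e a b d)) := by
    have hp := symmTensor_cubicSum c p
    have hQ := symmTensor_cubicSum (fun i => PowerSeries.C (c i)) Z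
    constructor
    · intro a b d
      simp only [hcoeff, cubicError]
      rw [hQ.1, hp.1, hH.1]
    · intro a b d
      simp only [hcoeff, cubicError]
      rw [hQ.2, hp.2, hH.2]
  obtain ⟨δ, hδ⟩ := hsurj _ hsymm
  refine ⟨fun i k => Z i k + PowerSeries.X ^ (m + 1) * PowerSeries.C (δ i k), ?_, ?_, ?_⟩
  · intro i a
    simp [hZ]
  · intro a b d
    obtain ⟨r, hr⟩ := cubicSum_add_mul (fun i => PowerSeries.C (c i)) Z
      (fun i k => PowerSeries.C (δ i k)) (PowerSeries.X ^ (m + 1)) a b d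
    have hlin : PowerSeries.X ∣ e a b d + cubicSumDeriv (fun i => PowerSeries.C (c i)) Z
        (fun i k => PowerSeries.C (δ i k)) a b d := by
      rw [PowerSeries.X_dvd_iff, map_add, map_cubicSumDeriv]
      simp only [PowerSeries.constantCoeff_C, hZ]
      rw [congrFun (congrFun (congrFun hδ a) b) d]
      ring
    obtain ⟨g, hg⟩ := hlin
    refine ⟨g + PowerSeries.X ^ m * r, ?_⟩
    have := he a b d
    unfold cubicError at this ⊢
    rw [hr]
    linear_combination this + PowerSeries.X ^ (m + 1) * hg
  · intro i a
    simp

/-- Newton's method for cubic tensor decompositions over the ring of power series. -/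
theorem exists_powerSeries_cubicSum
    (hsurj : ∀ T : n → n → n → K, SymmTensor T → ∃ δ, cubicSumDeriv c p δ = T)
    (hH : SymmTensor H) :
    ∃ Z : ι → n → PowerSeries K, (∀ i a, PowerSeries.constantCoeff (Z i a) = p i a) ∧
      ∀ a b d, cubicSum (fun i => PowerSeries.C (c i)) Z a b d =
        PowerSeries.C (cubicSum c p a b d) + PowerSeries.X * PowerSeries.C (H a b d) := by
  let P : ℕ → (ι → n → PowerSeries K) → Prop := fun m Z =>
    (∀ i a, PowerSeries.constantCoeff (Z i a) = p i a) ∧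
      ∀ a b d, PowerSeries.X ^ (m + 1) ∣ cubicError c p H Z a b d
  have h0 : P 0 fun i k => PowerSeries.C (p i k) := by
    refine ⟨fun i a => by simp, fun a b d => ?_⟩
    rw [zero_add, pow_one, PowerSeries.X_dvd_iff, cubicError, map_sub, map_cubicSum]
    simp
  have hstep : ∀ m (Z : {Z // P m Z}), ∃ Z' : {Z // P (m + 1) Z},
      ∀ i a, PowerSeries.X ^ (m + 1) ∣ Z'.1 i a - Z.1 i a := by
    intro m Z
    obtain ⟨Z', h1, h2, h3⟩ := exists_newton_step hsurj hH m Z.1 Z.2.1 Z.2.2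
    exact ⟨⟨Z', h1, h2⟩, h3⟩
  choose next hnext using hstep
  let S : ∀ m, {Z // P m Z} := fun m => Nat.rec ⟨_, h0⟩ next m
  have hS : ∀ m i a, PowerSeries.X ^ (m + 1) ∣ (S (m + 1)).1 i a - (S m).1 i a :=
    fun m => hnext m (S m)
  have hS' : ∀ m k i a, PowerSeries.X ^ (m + 1) ∣ (S (m + k)).1 i a - (S m).1 i a := by
    intro m k i a
    induction k with
    | zero => simp
    | succ k ih =>
      have := dvd_add ((pow_dvd_pow PowerSeries.X (by omega)).trans (hS (m + k) i a)) ih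
      rw [sub_add_sub_cancel] at this
      exact this
  let L : ι → n → PowerSeries K := fun i a =>
    PowerSeries.mk fun k => PowerSeries.coeff k ((S k).1 i a)
  have hL : ∀ m i a, PowerSeries.X ^ (m + 1) ∣ L i a - (S m).1 i a := by
    intro m i a
    rw [PowerSeries.X_pow_dvd_iff]
    intro k hk
    obtain ⟨j, rfl⟩ := Nat.exists_eq_add_of_le (Nat.lt_succ_iff.1 hk)
    have := PowerSeries.X_pow_dvd_iff.1 (hS' k j i a) k (Nat.lt_succ_self k)
    rw [map_sub, sub_eq_zero] at this
    simp [L, this]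
  refine ⟨L, fun i a => ?_, fun a b d => ?_⟩
  · have := PowerSeries.X_dvd_iff.1 (by simpa using hL 0 i a)
    rw [map_sub, sub_eq_zero] at this
    rw [this, (S 0).2.1]
  · rw [← sub_eq_zero]
    refine PowerSeries.eq_zero_of_forall_X_pow_dvd fun m => ?_
    choose δ hδ using hL m
    have hLm : L = fun i k => (S m).1 i k + PowerSeries.X ^ (m + 1) * δ i k := by
      funext i k
      rw [← hδ]
      ring
    obtain ⟨r, hr⟩ := cubicSum_add_mul (fun i => PowerSeries.C (c i)) (S m).1 δ
      (PowerSeries.X ^ (m + 1)) a b d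
    obtain ⟨e, he⟩ := (S m).2.2 a b d
    rw [hLm, hr]
    refine ⟨e + cubicSumDeriv (fun i => PowerSeries.C (c i)) (S m).1 δ a b d +
      PowerSeries.X ^ (m + 1) * r, ?_⟩
    unfold cubicError at he
    linear_combination he

end Newton

section Expansion

variable {K R : Type*} [Field K] [CommRing R] [IsDomain R] [IsDiscreteValuationRing R]
  [Algebra K R]

/-- A discrete valuation ring containing its residue field embeds into a power series ring. -/
theorem exists_powerSeries_expansion
    (hres : ∀ r : R, ∃ a : K, r - algebraMap K R a ∈ IsLocalRing.maximalIdeal R) :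
    ∃ T : R →ₐ[K] PowerSeries K, Function.Injective T ∧
      ∀ r ∈ IsLocalRing.maximalIdeal R, PowerSeries.constantCoeff (T r) = 0 := by
  obtain ⟨ϖ, hϖ⟩ := IsDiscreteValuationRing.exists_irreducible R
  have hmax := hϖ.maximalIdeal_eq
  have hex : ∀ r : R, ∃ a : K, ∃ s : R, r = algebraMap K R a + ϖ * s := by
    intro r
    obtain ⟨a, ha⟩ := hres r
    rw [hmax, Ideal.mem_span_singleton] at ha
    obtain ⟨s, hs⟩ := ha
    exact ⟨a, s, by rw [← hs]; ring⟩
  choose A D hAD using hex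
  have huniq : ∀ (r : R) (a : K) (s : R), r = algebraMap K R a + ϖ * s → A r = a ∧ D r = s := by
    intro r a s h
    rw [hAD r] at h
    have ha : A r = a := by
      by_contra hne
      have hmem : algebraMap K R (A r - a) ∈ IsLocalRing.maximalIdeal R := by
        rw [hmax, Ideal.mem_span_singleton]
        exact ⟨s - D r, by rw [map_sub]; linear_combination h⟩
      exact (IsLocalRing.mem_maximalIdeal _).1 hmem
        ((IsUnit.mk0 _ (sub_ne_zero.2 hne)).map (algebraMap K R))
    refine ⟨ha, mul_left_cancel₀ hϖ.ne_zero ?_⟩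
    rw [ha] at h
    exact add_left_cancel h
  have hadd : ∀ r s, A (r + s) = A r + A s ∧ D (r + s) = D r + D s := fun r s =>
    huniq _ _ _ (by rw [map_add]; linear_combination hAD r + hAD s)
  have hsmul : ∀ (a : K) r, A (algebraMap K R a * r) = a * A r ∧
      D (algebraMap K R a * r) = algebraMap K R a * D r := fun a r =>
    huniq _ _ _ (by rw [map_mul]; linear_combination algebraMap K R a * hAD r)
  have hmul : ∀ r s, A (r * s) = A r * A s ∧
      D (r * s) = algebraMap K R (A r) * D s + D r * s := fun r s =>
    huniq _ _ _ (by
      rw [map_mul]; linear_combination s * hAD r + algebraMap K R (A r) * hAD s)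
  have hC : ∀ a : K, A (algebraMap K R a) = a ∧ D (algebraMap K R a) = 0 := fun a =>
    huniq _ _ _ (by ring)
  let T : R → PowerSeries K := fun r => PowerSeries.mk fun n => A (D^[n] r)
  have hT : ∀ r, T r = PowerSeries.C (A r) + PowerSeries.X * T (D r) := by
    intro r
    ext n
    rcases n with _ | n
    · simp [T]
    · simp [T, PowerSeries.coeff_succ_X_mul]
  have hTadd : ∀ r s, T (r + s) = T r + T s := by
    intro r s
    ext n
    induction n generalizing r s with
    | zero => simp [T, hadd]
    | succ n ih =>
      have := ih (D r) (D s)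
      rw [hT, hT r, hT s, (hadd r s).2]
      simp only [map_add, PowerSeries.coeff_succ_X_mul, PowerSeries.coeff_succ_C] at this ⊢
      rw [this]
      ring
  have hTsmul : ∀ a r, T (algebraMap K R a * r) = PowerSeries.C a * T r := by
    intro a r
    ext n
    induction n generalizing r with
    | zero => simp [T, hsmul]
    | succ n ih =>
      have := ih (D r)
      rw [hT, hT r, (hsmul a r).2]
      simp only [map_add, mul_add, PowerSeries.coeff_succ_X_mul, PowerSeries.coeff_succ_C,
        PowerSeries.coeff_C_mul] at this ⊢
      rw [this]
      ring
  have hTmul : ∀ r s, T (r * s) = T r * T s := by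
    intro r s
    ext n
    induction n generalizing r s with
    | zero => simp [T, hmul]
    | succ n ih =>
      have h1 := ih (D r) s
      rw [hT, (hmul r s).2, hTadd, hTsmul, hT r, add_mul, mul_assoc PowerSeries.X]
      simp only [map_add, PowerSeries.coeff_succ_X_mul, PowerSeries.coeff_succ_C,
        PowerSeries.coeff_C_mul]
      rw [h1, hT s]
      simp only [map_add, PowerSeries.coeff_succ_X_mul, PowerSeries.coeff_succ_C]
      ring
  have hTC : ∀ a, T (algebraMap K R a) = PowerSeries.C a := by
    intro a
    have h0 : T 0 = 0 := by simpa using hTadd 0 0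
    rw [hT, (hC a).1, (hC a).2, h0, mul_zero, add_zero]
  let F : R →ₐ[K] PowerSeries K :=
    { toFun := T
      map_one' := by simpa using hTC 1
      map_mul' := hTmul
      map_zero' := by simpa using hTC 0
      map_add' := hTadd
      commutes' := fun a => by rw [hTC]; rfl }
  refine ⟨F, (injective_iff_map_eq_zero F).2 fun r hr => ?_, fun r hr => ?_⟩
  · have hA : ∀ n, A (D^[n] r) = 0 := fun n => by
      have := congrArg (PowerSeries.coeff n) hr
      simpa [F, T] using this
    have hpow : ∀ n, r = ϖ ^ n * D^[n] r := by
      intro n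
      induction n with
      | zero => simp
      | succ n ih =>
        have := hAD (D^[n] r)
        rw [hA n, map_zero, zero_add] at this
        rw [Function.iterate_succ_apply', pow_succ, mul_assoc, ← this, ← ih]
    have hinf := Ideal.iInf_pow_eq_bot_of_isLocalRing (IsLocalRing.maximalIdeal R)
      (Ideal.IsPrime.ne_top inferInstance)
    rw [← Ideal.mem_bot, ← hinf, Ideal.mem_iInf]
    intro n
    rw [hmax, Ideal.span_singleton_pow, Ideal.mem_span_singleton]
    exact ⟨_, hpow n⟩
  · rw [hmax, Ideal.mem_span_singleton] at hr
    obtain ⟨s, rfl⟩ := hr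
    have := (huniq (ϖ * s) 0 s (by simp)).1
    simp [F, T, this]

end Expansion

section Arc

open Polynomial

variable {K : Type*} [Field K]

/-- The completion of a Dedekind domain at a rational point. -/
theorem exists_powerSeries_expansion_of_isDedekindDomain {O : Type*} [CommRing O]
    [IsDedekindDomain O] [Algebra K O] (P : Ideal O) [P.IsPrime] (hP0 : P ≠ ⊥)
    (hres : ∀ x : O, ∃ b : K, x - algebraMap K O b ∈ P) :
    ∃ T : O →ₐ[K] PowerSeries K, Function.Injective T ∧
      ∀ x ∈ P, PowerSeries.constantCoeff (T x) = 0 := by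
  let R := Localization.AtPrime P
  have : IsDiscreteValuationRing R :=
    IsLocalization.AtPrime.isDiscreteValuationRing_of_dedekind_domain O hP0 R
  have hmem : ∀ z : O, z ∈ P → algebraMap O R z ∈ IsLocalRing.maximalIdeal R := fun z hz =>
    (IsLocalization.AtPrime.to_map_mem_maximal_iff R P z).2 hz
  have hresR : ∀ r : R, ∃ b : K, r - algebraMap K R b ∈ IsLocalRing.maximalIdeal R := by
    intro r
    obtain ⟨x, s, rfl⟩ := IsLocalization.exists_mk'_eq P.primeCompl r
    obtain ⟨α, hα⟩ := hres x
    obtain ⟨β, hβ⟩ := hres s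
    have hβ0 : β ≠ 0 := by
      rintro rfl
      exact s.2 (by simpa using hβ)
    refine ⟨α / β, ?_⟩
    have hunit : IsUnit (algebraMap O R s) := IsLocalization.map_units R s
    have hspec := IsLocalization.mk'_spec' R x s
    rw [← Ideal.unit_mul_mem_iff_mem _ hunit, mul_sub, hspec]
    have h1 := hmem _ hα
    have h2 := Ideal.mul_mem_left _ (algebraMap K R (α / β)) (hmem _ hβ)
    rw [map_sub, ← IsScalarTower.algebraMap_apply K O R] at h1 h2
    have h3 : algebraMap K R (α / β) * algebraMap K R β = algebraMap K R α := by
      rw [← map_mul, div_mul_cancel₀ _ hβ0]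
    convert sub_mem h1 h2 using 1
    linear_combination -h3
  obtain ⟨T, hTinj, hT0⟩ := exists_powerSeries_expansion hresR
  refine ⟨T.comp (IsScalarTower.toAlgHom K O R), ?_, fun x hx => hT0 _ (hmem x hx)⟩
  exact hTinj.comp (IsLocalization.injective R P.primeCompl_le_nonZeroDivisors)

/-- Rationality of the points of a curve over an algebraically closed field. -/
theorem exists_sub_algebraMap_mem_of_isIntegral [IsAlgClosed K] {O : Type*} [CommRing O]
    [Algebra K O] [Algebra K[X] O] [IsScalarTower K K[X] O] [Algebra.IsIntegral K[X] O]
    (P : Ideal O) [P.IsMaximal] {a : K} (ha : algebraMap K[X] O (X - C a) ∈ P) (x : O) :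
    ∃ b : K, x - algebraMap K O b ∈ P := by
  let := Ideal.Quotient.field P
  have hXq : algebraMap K[X] (O ⧸ P) = (algebraMap K (O ⧸ P)).comp (evalRingHom a) := by
    ext g
    · simp [IsScalarTower.algebraMap_apply K K[X] (O ⧸ P)]
    · have h0 : algebraMap K[X] (O ⧸ P) (X - C a) = 0 := by
        rw [IsScalarTower.algebraMap_apply K[X] O (O ⧸ P)]
        exact Ideal.Quotient.eq_zero_iff_mem.2 ha
      rw [map_sub, sub_eq_zero] at h0
      simp [h0, IsScalarTower.algebraMap_apply K K[X] (O ⧸ P)]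
  have hint : Algebra.IsIntegral K (O ⧸ P) := by
    refine ⟨fun y => ?_⟩
    obtain ⟨p, hp, hpy⟩ := Algebra.IsIntegral.isIntegral (R := K[X]) y
    refine ⟨p.map (evalRingHom a), hp.map _, ?_⟩
    rwa [eval₂_map, ← hXq]
  obtain ⟨b, hb⟩ := (IsAlgClosed.algebraMap_bijective_of_isIntegral (k := K)).2
    (Ideal.Quotient.mk P x)
  exact ⟨b, Ideal.Quotient.eq.1 hb.symm⟩

variable [IsAlgClosed K] [CharZero K]

/-- A finite extension of the rational function field embeds into the field of Laurent series
with the parameter specializing to any prescribed value. -/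
theorem exists_laurentSeries_embedding (M : Type*) [Field M] [Algebra K[X] M]
    [Algebra (FractionRing K[X]) M] [IsScalarTower K[X] (FractionRing K[X]) M]
    [FiniteDimensional (FractionRing K[X]) M] (a : K) :
    ∃ (θ : K[X] →ₐ[K] PowerSeries K) (Θ : M →+* LaurentSeries K),
      (∀ g, Θ (algebraMap K[X] M g) = algebraMap (PowerSeries K) (LaurentSeries K) (θ g)) ∧
      ∀ g, PowerSeries.constantCoeff (θ g) = g.eval a := by
  have hcz : CharZero (FractionRing K[X]) :=
    charZero_of_injective_algebraMap (IsFractionRing.injective K[X] (FractionRing K[X]))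
  let O := integralClosure K[X] M
  have hinj : Function.Injective (algebraMap K[X] M) := by
    rw [IsScalarTower.algebraMap_eq K[X] (FractionRing K[X]) M]
    exact (algebraMap (FractionRing K[X]) M).injective.comp (IsFractionRing.injective _ _)
  have hinjO : Function.Injective (algebraMap K[X] O) := by
    refine Function.Injective.of_comp (f := algebraMap O M) ?_
    rwa [← RingHom.coe_comp, ← IsScalarTower.algebraMap_eq]
  have : IsDedekindDomain O := IsIntegralClosure.isDedekindDomain K[X] (FractionRing K[X]) M O
  have : IsFractionRing O M :=
    IsIntegralClosure.isFractionRing_of_finite_extension K[X] (FractionRing K[X]) M O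
  let : Algebra K O := ((algebraMap K[X] O).comp C).toAlgebra
  have : IsScalarTower K K[X] O := IsScalarTower.of_algebraMap_eq' rfl
  have hXa : (Ideal.span {(X - C a : K[X])}).IsMaximal :=
    PrincipalIdealRing.isMaximal_of_irreducible (irreducible_X_sub_C a)
  obtain ⟨P, hP, hPX⟩ := Ideal.exists_ideal_over_maximal_of_isIntegral (S := O)
    (Ideal.span {(X - C a : K[X])}) (by
      rw [(RingHom.injective_iff_ker_eq_bot _).1 hinjO]; exact bot_le)
  have hXP : algebraMap K[X] O (X - C a) ∈ P := by
    rw [← Ideal.mem_comap, hPX]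
    exact Ideal.mem_span_singleton_self _
  have hP0 : P ≠ ⊥ := by
    rintro rfl
    rw [Ideal.mem_bot, map_eq_zero_iff _ hinjO] at hXP
    exact X_sub_C_ne_zero a hXP
  obtain ⟨T, hTinj, hT0⟩ := exists_powerSeries_expansion_of_isDedekindDomain P hP0
    (exists_sub_algebraMap_mem_of_isIntegral P hXP)
  let Φ : O →+* LaurentSeries K :=
    (algebraMap (PowerSeries K) (LaurentSeries K)).comp T.toRingHom
  have hΦ : Function.Injective Φ :=
    (IsFractionRing.injective (PowerSeries K) (LaurentSeries K)).comp hTinj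
  refine ⟨T.comp (IsScalarTower.toAlgHom K K[X] O), IsFractionRing.lift hΦ, fun g => ?_,
    fun g => ?_⟩
  · rw [IsScalarTower.algebraMap_apply K[X] O M, IsFractionRing.lift_algebraMap]
    rfl
  · obtain ⟨q, hq⟩ := X_sub_C_dvd_sub_C_eval (a := a) (p := g)
    rw [sub_eq_iff_eq_add] at hq
    set θ := T.comp (IsScalarTower.toAlgHom K K[X] O)
    have h0 : PowerSeries.constantCoeff (θ (X - C a)) = 0 := hT0 _ hXP
    have hC : θ (C (g.eval a)) = PowerSeries.C (g.eval a) := θ.commutes _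
    conv_lhs => rw [hq]
    rw [map_add, map_mul, map_add, map_mul, h0, zero_mul, zero_add, hC,
      PowerSeries.constantCoeff_C]

/-- A polynomial system over `K[X]` solvable over some field containing `K[X]` is solvable over
the Laurent series field, with `X` specializing to any prescribed value. -/
theorem exists_laurentSeries_solution {σ L : Type*} [Finite σ] [Field L] {φ : K[X] →+* L}
    (hφ : Function.Injective φ) (S : Set (MvPolynomial σ K[X])) (x₀ : σ → L)
    (hx₀ : ∀ f ∈ S, MvPolynomial.eval₂ φ x₀ f = 0) (a : K) :
    ∃ (θ : K[X] →ₐ[K] PowerSeries K) (x : σ → LaurentSeries K),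
      (∀ f ∈ S, MvPolynomial.eval₂
        ((algebraMap (PowerSeries K) (LaurentSeries K)).comp θ.toRingHom) x f = 0) ∧
      ∀ g, PowerSeries.constantCoeff (θ g) = g.eval a := by
  let k := FractionRing K[X]
  let φ' : k →+* L := IsFractionRing.lift hφ
  let ι : MvPolynomial σ K[X] →+* MvPolynomial σ k := MvPolynomial.map (algebraMap K[X] k)
  let J : Ideal (MvPolynomial σ k) := Ideal.span (ι '' S)
  have hφ' : φ'.comp (algebraMap K[X] k) = φ :=
    RingHom.ext fun g => IsFractionRing.lift_algebraMap hφ g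
  have hJ : J ≠ ⊤ := by
    have hle : J ≤ RingHom.ker (MvPolynomial.eval₂Hom φ' x₀) := by
      rw [Ideal.span_le]
      rintro _ ⟨f, hf, rfl⟩
      have := hx₀ f hf
      simp only [SetLike.mem_coe, RingHom.mem_ker, ι, MvPolynomial.coe_eval₂Hom,
        MvPolynomial.eval₂_map, hφ', this]
    exact fun h => RingHom.ker_ne_top _ (top_le_iff.1 (h ▸ hle))
  obtain ⟨m, hm, hJm⟩ := Ideal.exists_le_maximal J hJ
  let M := MvPolynomial σ k ⧸ m
  let : Field M := Ideal.Quotient.field m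
  have : FiniteDimensional k M := finite_of_finite_type_of_isJacobsonRing k M
  obtain ⟨θ, Θ, hΘ, hθ⟩ := exists_laurentSeries_embedding M a
  refine ⟨θ, fun i => Θ (Ideal.Quotient.mk m (MvPolynomial.X i)), fun f hf => ?_, hθ⟩
  have hf0 : Ideal.Quotient.mk m (ι f) = 0 :=
    Ideal.Quotient.eq_zero_iff_mem.2 (hJm (Ideal.subset_span ⟨f, hf, rfl⟩))
  have key : (MvPolynomial.eval₂Hom
      ((algebraMap (PowerSeries K) (LaurentSeries K)).comp θ.toRingHom)
      fun i => Θ (Ideal.Quotient.mk m (MvPolynomial.X i))) =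
      Θ.comp ((Ideal.Quotient.mk m).comp ι) := by
    refine MvPolynomial.ringHom_ext (fun g => ?_) fun i => ?_
    · have := hΘ g
      simp only [MvPolynomial.coe_eval₂Hom, MvPolynomial.eval₂_C, RingHom.comp_apply, ι,
        MvPolynomial.map_C]
      exact this.symm
    · simp [ι]
  rw [← MvPolynomial.coe_eval₂Hom, key, RingHom.comp_apply, RingHom.comp_apply, hf0, map_zero]

end Arc

section Decomposition

open Polynomial

variable {K : Type*} [Field K] [IsAlgClosed K] [CharZero K]

/-- Every symmetric tensor on `K⁶` whose contraction with `(1, …, 1)` vanishes is a limit of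
tensors with the same property that are sums of twelve cubes of points on the
hyperplane `∑ₐ Zₐ = 1`. -/
theorem exists_laurentSeries_cubicSum {T : Fin 6 → Fin 6 → Fin 6 → K} (hT : SymmTensor T)
    (hT0 : ∀ a b, ∑ d, T a b d = 0) :
    ∃ (c : Fin 6 ⊕ Fin 6 → LaurentSeries K) (Z : Fin 6 ⊕ Fin 6 → Fin 6 → LaurentSeries K)
      (g : Fin 6 → Fin 6 → Fin 6 → PowerSeries K),
      (∀ i, ∑ a, Z i a = 1) ∧ (∀ a b, ∑ d, g a b d = 0) ∧
      (∀ a b d, PowerSeries.constantCoeff (g a b d) = T a b d) ∧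
      ∀ a b d, cubicSum c Z a b d = algebraMap (PowerSeries K) (LaurentSeries K) (g a b d) := by
  set F := cubicSum (baseWeight K) (basePoint K) with hF
  have hF0 : ∀ a b, ∑ d, F a b d = 0 := sum_cubicSum_basePoint
  have hsymm : SymmTensor (fun a b d => T a b d - F a b d) := by
    have hF' := symmTensor_cubicSum (baseWeight K) (basePoint K)
    exact ⟨fun a b d => congrArg₂ _ (hT.1 a b d) (hF'.1 a b d),
      fun a b d => congrArg₂ _ (hT.2 a b d) (hF'.2 a b d)⟩
  obtain ⟨Y, hY, hYF⟩ := exists_powerSeries_cubicSum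
    (fun T hT => exists_cubicSumDeriv_basePoint hT) hsymm
  let j := algebraMap (PowerSeries K) (LaurentSeries K)
  have hj : Function.Injective j := IsFractionRing.injective _ _
  have hl : ∀ i, j (∑ a, Y i a) ≠ 0 := by
    intro i
    rw [map_ne_zero_iff j hj]
    intro h
    have := congrArg PowerSeries.constantCoeff h
    simp only [map_sum, hY, map_zero] at this
    exact sum_basePoint_ne_zero i this
  let G : Fin 6 → Fin 6 → Fin 6 → K[X] := fun a b d => C (F a b d) + X * C (T a b d - F a b d)
  let κ := Fin 6 ⊕ Fin 6
  let pc : κ → MvPolynomial (κ ⊕ κ × Fin 6) K[X] := fun i => MvPolynomial.X (Sum.inl i)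
  let pZ : κ → Fin 6 → MvPolynomial (κ ⊕ κ × Fin 6) K[X] :=
    fun i a => MvPolynomial.X (Sum.inr (i, a))
  let S : Set (MvPolynomial (κ ⊕ κ × Fin 6) K[X]) :=
    Set.range (fun i => ∑ a, pZ i a - 1) ∪
      Set.range (fun t : Fin 6 × Fin 6 × Fin 6 =>
        cubicSum pc pZ t.1 t.2.1 t.2.2 - MvPolynomial.C (G t.1 t.2.1 t.2.2))
  let φ : K[X] →+* LaurentSeries K := j.comp Polynomial.coeToPowerSeries.ringHom
  have hφ : Function.Injective φ := hj.comp (Polynomial.coe_injective K)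
  have hφG : ∀ a b d, φ (G a b d) = cubicSum (fun i => j (PowerSeries.C (baseWeight K i)))
      (fun i k => j (Y i k)) a b d := by
    intro a b d
    rw [← map_cubicSum j, hYF]
    simp [φ, G, hF]
  obtain ⟨θ, x, hx, hθ⟩ := exists_laurentSeries_solution hφ S
    (Sum.elim (fun i => j (PowerSeries.C (baseWeight K i)) * j (∑ a, Y i a) ^ 3)
      fun t => j (Y t.1 t.2) / j (∑ a, Y t.1 a)) (by
    rintro _ (⟨i, rfl⟩ | ⟨⟨a, b, d⟩, rfl⟩)
    · rw [← MvPolynomial.coe_eval₂Hom]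
      simp only [map_sub, map_sum, map_one, MvPolynomial.coe_eval₂Hom, MvPolynomial.eval₂_X, pZ,
        Sum.elim_inr, ← Finset.sum_div]
      rw [← map_sum, div_self (hl i), sub_self]
    · rw [← MvPolynomial.coe_eval₂Hom, map_sub, map_cubicSum]
      simp only [MvPolynomial.coe_eval₂Hom, MvPolynomial.eval₂_C, MvPolynomial.eval₂_X, pZ, pc,
        Sum.elim_inr, Sum.elim_inl, hφG, sub_eq_zero]
      refine Finset.sum_congr rfl fun i _ => ?_
      have := hl i
      field_simp) 1
  refine ⟨fun i => x (Sum.inl i), fun i a => x (Sum.inr (i, a)), fun a b d => θ (G a b d),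
    fun i => ?_, fun a b => ?_, fun a b d => ?_, fun a b d => ?_⟩
  · have := hx _ (Or.inl ⟨i, rfl⟩)
    rw [← MvPolynomial.coe_eval₂Hom] at this
    simpa [pZ, sub_eq_zero] using this
  · rw [← map_sum]
    simp only [G, Finset.sum_add_distrib, ← Finset.mul_sum, ← map_sum, Finset.sum_sub_distrib,
      hF0, hT0]
    simp
  · simp [hθ, G]
  · have := hx _ (Or.inr ⟨(a, b, d), rfl⟩)
    rw [← MvPolynomial.coe_eval₂Hom, map_sub, map_cubicSum, sub_eq_zero] at this
    simpa [pZ, pc] using this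

end Decomposition

section Gram

variable {R L P ι : Type*} [CommRing R] [Field L] [Algebra R L]
  [CommRing P] [Algebra R P] [Fintype ι] [DecidableEq ι] {ev : P →ₐ[R] ι → R} {γ : ι → L}
  {Φ : P →ₗ[R] R} {f : ι → P}

theorem gramMatrix_eq
    (hΦ : ∀ h, ∑ i, γ i * algebraMap R L (ev h i) = algebraMap R L (Φ h)) :
    (Matrix.of fun k l => Φ (f k * f l)).map (algebraMap R L) =
      Matrix.of (fun k i => algebraMap R L (ev (f k) i)) * Matrix.diagonal γ *
        (Matrix.of fun k i => algebraMap R L (ev (f k) i)).transpose := by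
  ext k l
  rw [Matrix.mul_apply]
  simp only [Matrix.map_apply, Matrix.of_apply, ← hΦ, map_mul, Pi.mul_apply,
    Matrix.mul_diagonal, Matrix.transpose_apply]
  exact Finset.sum_congr rfl fun i _ => by ring

theorem det_ne_zero_of_isUnit_gram [Nontrivial R]
    (hΦ : ∀ h, ∑ i, γ i * algebraMap R L (ev h i) = algebraMap R L (Φ h))
    (hG : IsUnit (Matrix.of fun k l => Φ (f k * f l)).det) :
    (Matrix.of fun k i => algebraMap R L (ev (f k) i)).det ≠ 0 ∧ ∀ i, γ i ≠ 0 := by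
  have h := hG.map (algebraMap R L)
  rw [RingHom.map_det, RingHom.mapMatrix_apply, gramMatrix_eq hΦ, Matrix.det_mul, Matrix.det_mul,
    Matrix.det_diagonal, isUnit_iff_ne_zero, mul_ne_zero_iff, mul_ne_zero_iff] at h
  exact ⟨h.1.1, fun i => Finset.prod_ne_zero_iff.1 h.1.2 i (Finset.mem_univ i)⟩

variable [FaithfulSMul R L]

theorem eq_zero_of_gram [Nontrivial R]
    (hΦ : ∀ h, ∑ i, γ i * algebraMap R L (ev h i) = algebraMap R L (Φ h))
    (hG : IsUnit (Matrix.of fun k l => Φ (f k * f l)).det) {h : P}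
    (hh : ∀ l, Φ (h * f l) = 0) : ev h = 0 := by
  obtain ⟨hM, hγ⟩ := det_ne_zero_of_isUnit_gram hΦ hG
  have h0 := Matrix.eq_zero_of_mulVec_eq_zero hM (v := fun i => γ i * algebraMap R L (ev h i)) (by
    funext l
    have := hΦ (h * f l)
    rw [hh, map_zero] at this
    rw [Pi.zero_apply, ← this]
    simp only [Matrix.mulVec, dotProduct, Matrix.of_apply, map_mul, Pi.mul_apply]
    exact Finset.sum_congr rfl fun i _ => by ring)
  funext i
  have := (mul_eq_zero.1 (congrFun h0 i)).resolve_left (hγ i)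
  exact (map_eq_zero_iff _ (FaithfulSMul.algebraMap_injective R L)).1 this

theorem eq_sum_of_gram [Nontrivial R]
    (hΦ : ∀ h, ∑ i, γ i * algebraMap R L (ev h i) = algebraMap R L (Φ h))
    (hG : IsUnit (Matrix.of fun k l => Φ (f k * f l)).det) (h : P) :
    ev h = ev (∑ k, Matrix.vecMul (fun l => Φ (h * f l))
      (Matrix.of fun k l => Φ (f k * f l))⁻¹ k • f k) := by
  rw [← sub_eq_zero, ← map_sub]
  refine eq_zero_of_gram hΦ hG fun l => ?_
  rw [sub_mul, map_sub, sub_eq_zero, Finset.sum_mul]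
  set w := Matrix.vecMul (fun l => Φ (h * f l)) (Matrix.of fun k l => Φ (f k * f l))⁻¹ with hw
  have : Matrix.vecMul w (Matrix.of fun k l => Φ (f k * f l)) = fun l => Φ (h * f l) := by
    rw [hw, Matrix.vecMul_vecMul, Matrix.nonsing_inv_mul _ hG, Matrix.vecMul_one]
  rw [← congrFun this l]
  simp [Matrix.vecMul, dotProduct]

theorem linearIndependent_of_gram [Nontrivial R]
    (hΦ : ∀ h, ∑ i, γ i * algebraMap R L (ev h i) = algebraMap R L (Φ h))
    (hG : IsUnit (Matrix.of fun k l => Φ (f k * f l)).det) :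
    LinearIndependent R fun k => ev (f k) := by
  rw [Fintype.linearIndependent_iff]
  intro r hr
  have hzero : ∀ x, ev x = 0 → Φ x = 0 := fun x hx => by
    apply FaithfulSMul.algebraMap_injective R L
    rw [← hΦ, hx]
    simp
  have : Matrix.vecMul r (Matrix.of fun k l => Φ (f k * f l)) = 0 := by
    funext l
    have h2 := hzero ((∑ k, r k • f k) * f l) (by
      rw [map_mul, map_sum]
      simp only [map_smul, hr, zero_mul])
    rw [Finset.sum_mul, map_sum] at h2
    simpa [Matrix.vecMul, dotProduct] using h2
  have h3 := congrArg (fun v => Matrix.vecMul v (Matrix.of fun k l => Φ (f k * f l))⁻¹) this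
  simp only [Matrix.vecMul_vecMul, Matrix.mul_nonsing_inv _ hG, Matrix.vecMul_one,
    Matrix.zero_vecMul] at h3
  exact congrFun h3

end Gram

open TensorProduct in
/-- An order of full rank in a split étale algebra is generically étale. -/
theorem etale_tensorProduct_of_basis {R L B ι : Type*} [CommRing R] [Nontrivial R] [Field L]
    [Algebra R L] [CommRing B] [Algebra R B] [Fintype ι] [DecidableEq ι] (v : Module.Basis ι R B)
    (e : B →ₐ[R] ι → L) (hdet : (Matrix.of fun k => e (v k)).det ≠ 0) :
    Algebra.Etale L (L ⊗[R] B) := by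
  have : Module.Free R B := .of_basis v
  have : Module.Finite R B := .of_basis v
  let F : L ⊗[R] B →ₐ[L] ι → L :=
    Algebra.TensorProduct.lift (Algebra.ofId L (ι → L)) e fun _ _ => mul_comm _ _
  have hFt : ∀ l x, F (l ⊗ₜ[R] x) = l • e x := fun l x => by
    refine (Algebra.TensorProduct.lift_tmul _ _ _ _ _).trans ?_
    rw [Algebra.smul_def, Algebra.ofId_apply]
  have hF : Function.Surjective F := by
    intro y
    let r := Matrix.vecMul y (Matrix.of fun k => e (v k))⁻¹
    refine ⟨∑ k, r k ⊗ₜ[R] v k, ?_⟩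
    have : Matrix.vecMul r (Matrix.of fun k => e (v k)) = y := by
      rw [Matrix.vecMul_vecMul, Matrix.nonsing_inv_mul _ (isUnit_iff_ne_zero.2 hdet),
        Matrix.vecMul_one]
    rw [← this, map_sum]
    funext i
    simp [hFt, Matrix.vecMul, dotProduct]
  have hrank : Module.finrank L (L ⊗[R] B) = Module.finrank L (ι → L) := by
    rw [Module.finrank_baseChange, Module.finrank_eq_card_basis v,
      Module.finrank_fintype_fun_eq_card]
  have hinj : Function.Injective F.toLinearMap :=
    (LinearMap.injective_iff_surjective_of_finrank_eq_finrank hrank).2 hF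
  have : Algebra.Etale L (ι → L) := {
    formallyEtale := (Algebra.FormallyEtale.pi_iff _).2 fun _ => inferInstance
    finitePresentation := inferInstance }
  exact Algebra.Etale.of_equiv (AlgEquiv.ofBijective F ⟨hinj, hF⟩).symm

/-- A finite algebra whose nondegenerate pairing lifts to a weighted sum of point evaluations
over the Laurent series field is smoothable. -/
theorem isSmoothable_of_evaluation {K A P ι : Type} [Field K] [CommRing A] [Algebra K A]
    [CommRing P] [Algebra K P] [Algebra (PowerSeries K) P] [IsScalarTower K (PowerSeries K) P]
    [Fintype ι] (b : Module.Basis ι K A) (ψ : A →ₗ[K] K)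
    (hψ : ∀ a, (∀ x, ψ (a * x) = 0) → a = 0) (π : P →ₐ[K] A) (hπ : Function.Surjective π)
    (hπR : ∀ r : PowerSeries K, π (algebraMap _ P r) =
      algebraMap K A (PowerSeries.constantCoeff r))
    (ev : P →ₐ[PowerSeries K] ι → PowerSeries K) (γ : ι → LaurentSeries K)
    (hev : ∀ f, ∃ g : PowerSeries K,
      ∑ i, γ i * algebraMap (PowerSeries K) (LaurentSeries K) (ev f i) =
        algebraMap (PowerSeries K) (LaurentSeries K) g ∧
      PowerSeries.constantCoeff g = ψ (π f)) :
    IsSmoothable K A (Fintype.card ι) := by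
  classical
  choose Φ₀ hΦ₀ hψΦ using hev
  have hj : Function.Injective (algebraMap (PowerSeries K) (LaurentSeries K)) :=
    IsFractionRing.injective _ _
  let Φ : P →ₗ[PowerSeries K] PowerSeries K :=
    { toFun := Φ₀
      map_add' := fun x y => hj (by
        rw [map_add, ← hΦ₀, ← hΦ₀, ← hΦ₀, ← Finset.sum_add_distrib]
        exact Finset.sum_congr rfl fun i _ => by rw [map_add, Pi.add_apply, map_add, mul_add])
      map_smul' := fun r x => hj (by
        rw [RingHom.id_apply, smul_eq_mul, map_mul, ← hΦ₀, ← hΦ₀, Finset.mul_sum]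
        refine Finset.sum_congr rfl fun i _ => ?_
        rw [map_smul, Pi.smul_apply, smul_eq_mul, map_mul]
        ring) }
  have hΦ : ∀ h, ∑ i, γ i * algebraMap (PowerSeries K) (LaurentSeries K) (ev h i) =
      algebraMap (PowerSeries K) (LaurentSeries K) (Φ h) := hΦ₀
  have hΦψ : ∀ h, PowerSeries.constantCoeff (Φ h) = ψ (π h) := hψΦ
  choose f hf using fun k => hπ (b k)
  have hG : IsUnit (Matrix.of fun k l => Φ (f k * f l)).det := by
    rw [PowerSeries.isUnit_iff_constantCoeff, RingHom.map_det, isUnit_iff_ne_zero]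
    intro h0
    obtain ⟨v, hv0, hv⟩ := Matrix.exists_vecMul_eq_zero_iff.2 h0
    have hA : ∑ k, v k • b k = 0 := hψ _ fun x => by
      rw [← b.sum_repr x, Finset.mul_sum, map_sum]
      refine Finset.sum_eq_zero fun l _ => ?_
      have := congrFun hv l
      simp only [Matrix.vecMul, dotProduct, RingHom.mapMatrix_apply, Matrix.map_apply,
        Matrix.of_apply, hΦψ, map_mul, hf, Pi.zero_apply] at this
      simp [Finset.sum_mul, this]
    exact hv0 (funext (Fintype.linearIndependent_iff.1 b.linearIndependent v hA))
  let I : Ideal P := RingHom.ker ev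
  have hle : ∀ x ∈ I, π x = 0 := fun x hx => hψ _ fun y => by
    obtain ⟨z, rfl⟩ := hπ y
    have h0 : Φ (x * z) = 0 := hj (by
      rw [← hΦ, map_mul, show ev x = 0 from hx]
      simp)
    rw [← map_mul, ← hΦψ, h0, map_zero]
  let ev' : P ⧸ I →ₐ[PowerSeries K] ι → PowerSeries K := Ideal.kerLiftAlg ev
  have hev' : Function.Injective ev' := Ideal.kerLiftAlg_injective ev
  have hev'mk : ∀ x, ev' (Ideal.Quotient.mk I x) = ev x := fun x => rfl
  have hli : LinearIndependent (PowerSeries K) fun k => Ideal.Quotient.mk I (f k) :=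
    LinearIndependent.of_comp ev'.toLinearMap (linearIndependent_of_gram hΦ hG)
  have hsum : ∀ x, Ideal.Quotient.mk I x =
      ∑ k, Matrix.vecMul (fun l => Φ (x * f l)) (Matrix.of fun k l => Φ (f k * f l))⁻¹ k •
        Ideal.Quotient.mk I (f k) := fun x => hev' (by
    rw [hev'mk, eq_sum_of_gram hΦ hG x]
    simp [hev'mk])
  let v : Module.Basis ι (PowerSeries K) (P ⧸ I) := .mk hli (by
    rintro y -
    obtain ⟨x, rfl⟩ := Ideal.Quotient.mk_surjective y
    rw [hsum x]
    exact Submodule.sum_mem _ fun k _ =>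
      Submodule.smul_mem _ _ (Submodule.subset_span (Set.mem_range_self k)))
  let ρ : P ⧸ I →ₐ[K] A := Ideal.Quotient.liftₐ I π hle
  have hρ : Function.Surjective ρ := Ideal.Quotient.lift_surjective_of_surjective I hle hπ
  have hρR : ∀ r : PowerSeries K, ρ (algebraMap _ (P ⧸ I) r) =
      algebraMap K A (PowerSeries.constantCoeff r) := hπR
  have hker : Ideal.span {algebraMap (PowerSeries K) (P ⧸ I) PowerSeries.X} = RingHom.ker ρ := by
    apply le_antisymm
    · rw [Ideal.span_singleton_le_iff_mem, RingHom.mem_ker, hρR]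
      simp
    · intro y hy
      obtain ⟨x, rfl⟩ := Ideal.Quotient.mk_surjective y
      have hx : π x = 0 := hy
      rw [hsum x]
      refine Ideal.sum_mem _ fun k _ => ?_
      have hdvd : PowerSeries.X ∣ Matrix.vecMul (fun l => Φ (x * f l))
          (Matrix.of fun k l => Φ (f k * f l))⁻¹ k := by
        refine Finset.dvd_sum fun l _ => Dvd.dvd.mul_right ?_ _
        rw [PowerSeries.X_dvd_iff, hΦψ, map_mul, hx, zero_mul, map_zero]
      obtain ⟨s, hs⟩ := hdvd
      rw [hs, Algebra.smul_def, map_mul, mul_assoc]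
      exact Ideal.mul_mem_right _ _ (Ideal.mem_span_singleton_self _)
  refine ⟨P ⧸ I, inferInstance, inferInstance, inferInstance, inferInstance, .of_basis v,
    Module.finrank_eq_card_basis v,
    ⟨(Ideal.quotientEquivAlgOfEq K hker).trans (Ideal.quotientKerAlgEquivOfSurjective hρ)⟩, ?_⟩
  refine etale_tensorProduct_of_basis v
    (((Algebra.ofId (PowerSeries K) (LaurentSeries K)).compLeft ι).comp ev') ?_
  convert (det_ne_zero_of_isUnit_gram hΦ hG).1 using 3
  funext k i
  simp [v, hev'mk, Algebra.ofId_apply]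

theorem MvPolynomial.mul_mem_of_mul_X_mul_mem {R τ : Type*} [CommRing R]
    {W : Submodule R (MvPolynomial τ R)} {q : MvPolynomial τ R} (hq : q ∈ W)
    (hX : ∀ a h, q * MvPolynomial.X a * h ∈ W) (h : MvPolynomial τ R) : q * h ∈ W := by
  induction h using MvPolynomial.induction_on with
  | C r =>
    rw [mul_comm, MvPolynomial.C_mul']
    exact W.smul_mem r hq
  | add f g hf hg =>
    rw [mul_add]
    exact W.add_mem hf hg
  | mul_X f a _ =>
    rw [mul_comm f, ← mul_assoc]
    exact hX a f

/-- A submodule of the polynomial ring containing all monomials of degree at most three and all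
multiples of those of degree four is everything. -/
theorem MvPolynomial.mem_of_cubic {R τ : Type*} [CommRing R]
    {W : Submodule R (MvPolynomial τ R)} (h0 : 1 ∈ W) (h1 : ∀ a, MvPolynomial.X a ∈ W)
    (h2 : ∀ a b, MvPolynomial.X a * MvPolynomial.X b ∈ W)
    (h3 : ∀ a b d, MvPolynomial.X a * MvPolynomial.X b * MvPolynomial.X d ∈ W)
    (h4 : ∀ a b d e h, MvPolynomial.X a * MvPolynomial.X b * MvPolynomial.X d *
      MvPolynomial.X e * h ∈ W) (f : MvPolynomial τ R) : f ∈ W := by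
  rw [← one_mul f]
  refine mul_mem_of_mul_X_mul_mem h0 (fun a => ?_) f
  rw [one_mul]
  exact mul_mem_of_mul_X_mul_mem (h1 a) fun b => mul_mem_of_mul_X_mul_mem (h2 a b) fun d =>
    mul_mem_of_mul_X_mul_mem (h3 a b d) fun e => h4 a b d e

/-- Finitely many Laurent series have a common denominator which is a power of the variable. -/
theorem LaurentSeries.exists_X_pow_mul {K ι : Type*} [Field K] [Finite ι]
    (f : ι → LaurentSeries K) :
    ∃ (p : ℕ) (f' : ι → PowerSeries K), ∀ i, algebraMap (PowerSeries K) (LaurentSeries K) (f' i) =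
      algebraMap (PowerSeries K) (LaurentSeries K) PowerSeries.X ^ p * f i := by
  obtain ⟨q, hb⟩ := IsLocalization.exist_integer_multiples_of_finite
    (Submonoid.powers (PowerSeries.X : PowerSeries K)) f
  obtain ⟨p, hp⟩ := Submonoid.mem_powers_iff _ _ |>.1 q.2
  choose f' hf' using hb
  refine ⟨p, f', fun i => ?_⟩
  rw [hf', ← map_pow, hp, ← Algebra.smul_def]

/-- The `K`-algebra map from polynomials over `K⟦X⟧` given by reduction modulo `X` and
evaluation at `y`. -/
noncomputable def residueAeval {K A τ : Type*} [Field K] [CommRing A] [Algebra K A] (y : τ → A) :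
    MvPolynomial τ (PowerSeries K) →ₐ[K] A :=
  { MvPolynomial.eval₂Hom ((algebraMap K A).comp PowerSeries.constantCoeff) y with
    commutes' := fun r => by
      simp [IsScalarTower.algebraMap_apply K (PowerSeries K) (MvPolynomial τ (PowerSeries K)),
        MvPolynomial.algebraMap_eq] }

section residueAeval

variable {K A τ : Type*} [Field K] [CommRing A] [Algebra K A] (y : τ → A)

@[simp]
theorem residueAeval_X (a : τ) : residueAeval (K := K) y (MvPolynomial.X a) = y a :=
  MvPolynomial.eval₂_X _ _ _

theorem residueAeval_algebraMap (r : PowerSeries K) :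
    residueAeval y (algebraMap _ (MvPolynomial τ (PowerSeries K)) r) =
      algebraMap K A (PowerSeries.constantCoeff r) :=
  MvPolynomial.eval₂_C _ _ _

theorem residueAeval_smul (r : PowerSeries K) (f : MvPolynomial τ (PowerSeries K)) :
    residueAeval y (r • f) = PowerSeries.constantCoeff r • residueAeval y f := by
  rw [Algebra.smul_def, map_mul, residueAeval_algebraMap, Algebra.smul_def]

theorem residueAeval_surjective
    (hy : Function.Surjective (MvPolynomial.aeval y : MvPolynomial τ K →ₐ[K] A)) :
    Function.Surjective (residueAeval (K := K) y) := by
  intro z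
  obtain ⟨f, rfl⟩ := hy z
  refine ⟨MvPolynomial.map PowerSeries.C f, ?_⟩
  refine (MvPolynomial.eval₂_map _ _ _ _).trans ?_
  rw [MvPolynomial.aeval_def]
  congr 1

end residueAeval

/-- An algebra with zero fourth powers of the augmentation ideal is smoothable as soon as its
cubic moments are limits of the cubic moments of finitely many points. -/
theorem isSmoothable_of_moments {K A ι τ : Type} [Field K] [CommRing A] [Algebra K A]
    [Fintype ι] [Finite τ] (b : Module.Basis ι K A) (ψ : A →ₗ[K] K)
    (hψ : ∀ a, (∀ x, ψ (a * x) = 0) → a = 0) (y : τ → A)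
    (hy : Function.Surjective (MvPolynomial.aeval y : MvPolynomial τ K →ₐ[K] A))
    (hy4 : ∀ a b d e, y a * y b * y d * y e = 0) (hψ0 : ψ 1 = 0) (hψ1 : ∀ a, ψ (y a) = 0)
    (hψ2 : ∀ a b, ψ (y a * y b) = 0) (c : ι → LaurentSeries K) (x : ι → τ → LaurentSeries K)
    (g : τ → τ → τ → PowerSeries K)
    (hg : ∀ a b d, PowerSeries.constantCoeff (g a b d) = ψ (y a * y b * y d))
    (hc0 : ∑ i, c i = 0) (hc1 : ∀ a, ∑ i, c i * x i a = 0)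
    (hc2 : ∀ a b, ∑ i, c i * (x i a * x i b) = 0)
    (hc3 : ∀ a b d, cubicSum c x a b d = algebraMap (PowerSeries K) (LaurentSeries K) (g a b d)) :
    IsSmoothable K A (Fintype.card ι) := by
  set j := algebraMap (PowerSeries K) (LaurentSeries K)
  obtain ⟨p, f', hf'⟩ := LaurentSeries.exists_X_pow_mul
    (Sum.elim c fun t : ι × τ => x t.1 t.2)
  set U := j PowerSeries.X with hU
  have hU0 : U ≠ 0 := (map_ne_zero_iff j (IsFractionRing.injective _ _)).2 PowerSeries.X_ne_zero
  have hc' : ∀ i, j (f' (Sum.inl i)) = U ^ p * c i := fun i => hf' (Sum.inl i)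
  have hx' : ∀ i a, j (f' (Sum.inr (i, a))) = U ^ p * x i a := fun i a => hf' (Sum.inr (i, a))
  let ξ : ι → τ → PowerSeries K := fun i a => PowerSeries.X ^ (4 * p + 1) * f' (Sum.inr (i, a))
  have hξ : ∀ i a, j (ξ i a) = U ^ (5 * p + 1) * x i a := fun i a => by
    rw [map_mul, map_pow, hx', ← hU]
    ring
  let γ : ι → LaurentSeries K := fun i => c i / U ^ (3 * (5 * p + 1))
  let ev : MvPolynomial τ (PowerSeries K) →ₐ[PowerSeries K] ι → PowerSeries K :=
    AlgHom.pi fun i => MvPolynomial.aeval (ξ i)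
  have hevX : ∀ i a, ev (MvPolynomial.X a) i = ξ i a := fun i a => by simp [ev]
  let W : Submodule (PowerSeries K) (MvPolynomial τ (PowerSeries K)) :=
    { carrier := {f | ∃ g : PowerSeries K, ∑ i, γ i * j (ev f i) = j g ∧
        PowerSeries.constantCoeff g = ψ (residueAeval y f)}
      add_mem' := by
        rintro f f' ⟨g, hg, hg'⟩ ⟨h, hh, hh'⟩
        refine ⟨g + h, ?_, by rw [map_add, map_add, map_add, hg', hh']⟩
        rw [map_add j, ← hg, ← hh, ← Finset.sum_add_distrib]
        exact Finset.sum_congr rfl fun i _ => by rw [map_add, Pi.add_apply, map_add, mul_add]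
      zero_mem' := ⟨0, by simp, by simp⟩
      smul_mem' := by
        rintro r f ⟨g, hg, hg'⟩
        refine ⟨r * g, ?_, by rw [residueAeval_smul, map_smul, map_mul, hg', smul_eq_mul]⟩
        rw [map_mul j, ← hg, Finset.mul_sum]
        refine Finset.sum_congr rfl fun i _ => ?_
        rw [map_smul, Pi.smul_apply, smul_eq_mul, map_mul]
        ring }
  refine isSmoothable_of_evaluation b ψ hψ (residueAeval y) (residueAeval_surjective y hy)
    (residueAeval_algebraMap y) ev γ fun f => MvPolynomial.mem_of_cubic (W := W) ?_ ?_ ?_ ?_ ?_ f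
  · refine ⟨0, ?_, by rw [map_one, hψ0, map_zero]⟩
    simp [γ, ← Finset.sum_div, hc0]
  · refine fun a => ⟨0, ?_, by rw [residueAeval_X, hψ1, map_zero]⟩
    calc _ = U ^ (5 * p + 1) / U ^ (3 * (5 * p + 1)) * ∑ i, c i * x i a := by
          rw [Finset.mul_sum]
          refine Finset.sum_congr rfl fun i _ => ?_
          rw [hevX, hξ]
          ring
      _ = j 0 := by rw [hc1, mul_zero, map_zero]
  · refine fun a b => ⟨0, ?_, by rw [map_mul, residueAeval_X, residueAeval_X, hψ2, map_zero]⟩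
    calc _ = (U ^ (5 * p + 1)) ^ 2 / U ^ (3 * (5 * p + 1)) * ∑ i, c i * (x i a * x i b) := by
          rw [Finset.mul_sum]
          refine Finset.sum_congr rfl fun i _ => ?_
          simp only [map_mul, Pi.mul_apply, hevX, hξ, γ]
          ring
      _ = j 0 := by rw [hc2, mul_zero, map_zero]
  · refine fun a b d => ⟨g a b d, ?_, by simp only [map_mul, residueAeval_X, hg]⟩
    rw [← hc3]
    refine Finset.sum_congr rfl fun i _ => ?_
    simp only [map_mul, Pi.mul_apply, hevX, hξ, γ]
    field_simp
    ring
  · refine fun a b d e h => ⟨PowerSeries.X * ∑ i, f' (Sum.inl i) * (f' (Sum.inr (i, a)) *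
      f' (Sum.inr (i, b)) * f' (Sum.inr (i, d)) * f' (Sum.inr (i, e))) * ev h i, ?_, ?_⟩
    · rw [map_mul j, map_sum j, ← hU, Finset.mul_sum]
      refine Finset.sum_congr rfl fun i _ => ?_
      simp only [map_mul, Pi.mul_apply, hevX, hξ, γ, hc', hx']
      field_simp
      ring
    · simp only [map_mul, residueAeval_X, hy4, zero_mul, map_zero,
        PowerSeries.constantCoeff_X]

/-- An algebra of dimension twelve generated by five elements with vanishing fourfold products is
smoothable if it has a nondegenerate functional vanishing on polynomials of degree at most two. -/
theorem isSmoothable_twelve {K A : Type} [Field K] [IsAlgClosed K] [CharZero K] [CommRing A]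
    [Algebra K A] (hA : Module.finrank K A = 12) (ψ : A →ₗ[K] K)
    (hψ : ∀ a, (∀ x, ψ (a * x) = 0) → a = 0) (y : Fin 5 → A)
    (hy : Function.Surjective (MvPolynomial.aeval y : MvPolynomial (Fin 5) K →ₐ[K] A))
    (hy4 : ∀ a b d e, y a * y b * y d * y e = 0) (hψ0 : ψ 1 = 0) (hψ1 : ∀ a, ψ (y a) = 0)
    (hψ2 : ∀ a b, ψ (y a * y b) = 0) : IsSmoothable K A 12 := by
  have : FiniteDimensional K A := FiniteDimensional.of_finrank_pos (by omega)
  let Z : Fin 6 → A := Fin.cons (1 - ∑ a, y a) y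
  have hZ1 : ∑ a, Z a = 1 := by simp [Fin.sum_univ_succ, Z]
  have hZ2 : ∀ a b, ψ (Z a * Z b) = 0 := by
    intro a b
    refine Fin.cases ?_ (fun a => ?_) a <;> refine Fin.cases ?_ (fun b => ?_) b <;>
      simp [Z, sub_mul, mul_sub, Finset.sum_mul, Finset.mul_sum, hψ0, hψ1, hψ2]
  obtain ⟨c, x, g, hx, hg0, hg, hcx⟩ := exists_laurentSeries_cubicSum
    (T := fun a b d => ψ (Z a * Z b * Z d))
    ⟨fun a b d => congrArg (fun t => ψ (t * Z d)) (mul_comm _ _),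
      fun a b d => congrArg ψ (mul_right_comm _ _ _)⟩
    (fun a b => by rw [← map_sum, ← Finset.mul_sum, hZ1, mul_one, hZ2])
  have hc2 : ∀ a b, ∑ i, c i * (x i a * x i b) = 0 := by
    intro a b
    calc _ = ∑ d, cubicSum c x a b d := by
          simp only [cubicSum]
          rw [Finset.sum_comm]
          simp only [← Finset.mul_sum, hx, mul_one]
      _ = 0 := by simp only [hcx, ← map_sum, hg0, map_zero]
  have hc1 : ∀ a, ∑ i, c i * x i a = 0 := by
    intro a
    calc _ = ∑ b, ∑ i, c i * (x i a * x i b) := by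
          rw [Finset.sum_comm]
          simp only [← Finset.mul_sum, hx, mul_one]
      _ = 0 := by simp only [hc2, Finset.sum_const_zero]
  have hc0 : ∑ i, c i = 0 := by
    calc _ = ∑ a, ∑ i, c i * x i a := by
          rw [Finset.sum_comm]
          simp only [← Finset.mul_sum, hx, mul_one]
      _ = 0 := by simp only [hc1, Finset.sum_const_zero]
  have hcard : Fintype.card (Fin 6 ⊕ Fin 6) = 12 := rfl
  let b : Module.Basis (Fin 6 ⊕ Fin 6) K A :=
    (Module.finBasis K A).reindex (Fintype.equivOfCardEq (by rw [Fintype.card_fin, hA, hcard]))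
  exact isSmoothable_of_moments b ψ hψ y hy hy4 hψ0 hψ1 hψ2 c (fun i a => x i a.succ)
    (fun a b d => g a.succ b.succ d.succ) (fun a b d => hg _ _ _) hc0 (fun a => hc1 _)
    (fun a b => hc2 _ _) fun a b d => hcx _ _ _

theorem Submodule.finite_and_finrank_eq_of_quotient {K V : Type*} [Field K] [AddCommGroup V]
    [Module K V] {N M : Submodule K V} (hNM : N ≤ M) [Module.Finite K N] {d : ℕ} (hd : d ≠ 0)
    (h : Module.finrank K (M ⧸ N.comap M.subtype) = d) :
    Module.Finite K M ∧ Module.finrank K M = d + Module.finrank K N := by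
  have : Module.Finite K (M ⧸ N.comap M.subtype) :=
    FiniteDimensional.of_finrank_pos (by omega)
  have : Module.Finite K (N.comap M.subtype) :=
    Module.Finite.equiv (Submodule.comapSubtypeEquivOfLe hNM).symm
  have hM : Module.Finite K M := Module.Finite.of_submodule_quotient (N.comap M.subtype)
  refine ⟨hM, ?_⟩
  rw [← Submodule.finrank_quotient_add_finrank (N.comap M.subtype), h,
    (Submodule.comapSubtypeEquivOfLe hNM).finrank_eq]

/-- Dimensions of a local algebra and of the square of its maximal ideal from the
Hilbert function. -/
theorem finrank_of_assocGradedDim {K A : Type} [Field K] [CommRing A] [Algebra K A]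
    [IsLocalRing A] (h0 : Module.finrank K (A ⧸ IsLocalRing.maximalIdeal A) = 1)
    (h1 : assocGradedDim K A 1 = 5) (h2 : assocGradedDim K A 2 = 5)
    (h3 : assocGradedDim K A 3 = 1) (h4 : IsLocalRing.maximalIdeal A ^ 4 = ⊥) :
    Module.Finite K A ∧ Module.finrank K A = 12 ∧
      Module.finrank K ((IsLocalRing.maximalIdeal A ^ 2).restrictScalars K) = 6 := by
  have hle : ∀ i, (IsLocalRing.maximalIdeal A ^ (i + 1)).restrictScalars K ≤
      (IsLocalRing.maximalIdeal A ^ i).restrictScalars K := fun i =>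
    Ideal.pow_le_pow_right i.le_succ
  have e4 : (IsLocalRing.maximalIdeal A ^ 4).restrictScalars K = ⊥ := by rw [h4]; rfl
  have f4 : Module.Finite K ((IsLocalRing.maximalIdeal A ^ 4).restrictScalars K) := by
    rw [e4]; infer_instance
  have d4 : Module.finrank K ((IsLocalRing.maximalIdeal A ^ 4).restrictScalars K) = 0 := by
    rw [e4, finrank_bot]
  obtain ⟨f3, d3⟩ := Submodule.finite_and_finrank_eq_of_quotient (hle 3) one_ne_zero h3
  obtain ⟨f2, d2⟩ := Submodule.finite_and_finrank_eq_of_quotient (hle 2) (by norm_num) h2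
  obtain ⟨f1, d1⟩ := Submodule.finite_and_finrank_eq_of_quotient (hle 1) (by norm_num) h1
  rw [pow_one] at f1 d1
  simp only [Nat.reduceAdd] at d1 d2 d3
  have q0 := (Submodule.Quotient.restrictScalarsEquiv K (IsLocalRing.maximalIdeal A)).finrank_eq
  rw [h0] at q0
  have : Module.Finite K (A ⧸ (IsLocalRing.maximalIdeal A).restrictScalars K) :=
    FiniteDimensional.of_finrank_pos (by omega)
  have fA : Module.Finite K A :=
    Module.Finite.of_submodule_quotient ((IsLocalRing.maximalIdeal A).restrictScalars K)
  have dA := Submodule.finrank_quotient_add_finrank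
    ((IsLocalRing.maximalIdeal A).restrictScalars K)
  exact ⟨fA, by omega, by omega⟩

/-- A functional that does not vanish on the one-dimensional socle of a local algebra with
nilpotent maximal ideal defines a nondegenerate pairing. -/
theorem exists_dual_nondegenerate {K A : Type*} [Field K] [CommRing A] [Algebra K A]
    [IsLocalRing A] {n : ℕ} (hn : IsLocalRing.maximalIdeal A ^ n = ⊥)
    (hgor : Module.finrank K
      (((⊥ : Ideal A).colon (IsLocalRing.maximalIdeal A)).restrictScalars K) = 1) :
    ∃ ψ : A →ₗ[K] K, ∀ a, (∀ x, ψ (a * x) = 0) → a = 0 := by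
  obtain ⟨e, he, hspan⟩ := finrank_eq_one_iff'.1 hgor
  obtain ⟨ψ, hψ⟩ : ∃ ψ : Module.Dual K A, ψ e ≠ 0 := by
    by_contra! h
    exact he (Subtype.ext ((Module.forall_dual_apply_eq_zero_iff K (e : A)).1 h))
  refine ⟨ψ, fun a ha => ?_⟩
  by_contra ha0
  classical
  have hex : ∃ i, ∀ z ∈ IsLocalRing.maximalIdeal A ^ i, a * z = 0 :=
    ⟨n, fun z hz => by rw [hn, Ideal.mem_bot] at hz; rw [hz, mul_zero]⟩
  obtain ⟨i, hi⟩ : ∃ i, Nat.find hex = i + 1 := by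
    refine Nat.exists_eq_succ_of_ne_zero fun h0 => ha0 ?_
    have := Nat.find_spec hex 1 (by rw [h0]; simp)
    rwa [mul_one] at this
  have hmin := Nat.find_min hex (m := i) (by omega)
  push Not at hmin
  obtain ⟨z, hz, hz0⟩ := hmin
  have hsoc : a * z ∈ ((⊥ : Ideal A).colon (IsLocalRing.maximalIdeal A)).restrictScalars K := by
    rw [Submodule.restrictScalars_mem, Submodule.mem_colon]
    intro t ht
    rw [smul_eq_mul, Ideal.mem_bot, mul_assoc]
    refine Nat.find_spec hex _ ?_
    rw [hi, pow_succ]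
    exact Ideal.mul_mem_mul hz ht
  obtain ⟨k, hk⟩ := hspan ⟨a * z, hsoc⟩
  have hk' : k • (e : A) = a * z := congrArg Subtype.val hk
  have h0 := ha z
  rw [← hk', map_smul, smul_eq_mul, mul_eq_zero, or_iff_left hψ] at h0
  rw [h0, zero_smul] at hk'
  exact hz0 hk'.symm

/-- Modulo a subspace of half the dimension that is self-orthogonal, every element can be moved
into a common isotropic position. -/
theorem exists_isotropic_lift {K A : Type*} [Field K] [CharZero K] [CommRing A] [Algebra K A]
    [Module.Finite K A] (ψ : A →ₗ[K] K) (hψ : ∀ a, (∀ x, ψ (a * x) = 0) → a = 0)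
    (N : Submodule K A) (hN : ∀ x ∈ N, ∀ y ∈ N, x * y = 0)
    (hdim : Module.finrank K A = 2 * Module.finrank K N) :
    ∃ z : A → A, (∀ w, z w - w ∈ N) ∧ ∀ v w, ψ (z v * z w) = 0 := by
  let Φ : A →ₗ[K] Module.Dual K A := (LinearMap.mul K A).compr₂ ψ
  have hΦ : Function.Injective Φ := (injective_iff_map_eq_zero Φ).2 fun a ha =>
    hψ a fun x => LinearMap.congr_fun ha x
  have hΦs : Function.Surjective Φ :=
    (LinearMap.injective_iff_surjective_of_finrank_eq_finrank Subspace.dual_finrank_eq.symm).1 hΦ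
  have hperp : N = N.dualAnnihilator.comap Φ := by
    refine Submodule.eq_of_le_of_finrank_eq (fun x hx => ?_) ?_
    · rw [Submodule.mem_comap, Submodule.mem_dualAnnihilator]
      exact fun y hy => by simp [Φ, hN x hx y hy]
    · have h1 := Subspace.finrank_add_finrank_dualAnnihilator_eq N
      have h2 := ((LinearEquiv.ofBijective Φ ⟨hΦ, hΦs⟩).submoduleMap
        (N.dualAnnihilator.comap Φ)).finrank_eq
      have h3 : (N.dualAnnihilator.comap Φ).map
          (LinearEquiv.ofBijective Φ ⟨hΦ, hΦs⟩ : A →ₗ[K] Module.Dual K A) = N.dualAnnihilator :=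
        Submodule.map_comap_eq_of_surjective hΦs _
      rw [h3] at h2
      omega
  obtain ⟨s, hs⟩ := N.mkQ.exists_rightInverse_of_surjective N.range_mkQ
  let p : A →ₗ[K] A := s ∘ₗ N.mkQ
  have hpN : ∀ x ∈ N, p x = 0 := fun x hx => by simp [p, (Submodule.Quotient.mk_eq_zero N).2 hx]
  have hp : ∀ x, p x - x ∈ N := fun x => by
    rw [← Submodule.Quotient.eq]
    exact LinearMap.congr_fun hs (N.mkQ x)
  have hpp : ∀ x, p (p x) = p x := fun x => by
    rw [← sub_eq_zero, ← map_sub]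
    exact hpN _ (hp x)
  have hq : ∀ w, ∃ q ∈ N, ∀ x, ψ (q * x) = -(2⁻¹ * ψ (p w * p x)) := by
    intro w
    obtain ⟨q, hq⟩ := hΦs (-((2⁻¹ : K) • (Φ (p w) ∘ₗ p)))
    refine ⟨q, ?_, fun x => LinearMap.congr_fun hq x⟩
    rw [hperp, Submodule.mem_comap, hq, Submodule.mem_dualAnnihilator]
    exact fun x hx => by simp [hpN x hx]
  choose q hqN hq using hq
  refine ⟨fun w => p w + q w, fun w => ?_, fun v w => ?_⟩
  · rw [add_sub_right_comm]
    exact N.add_mem (hp w) (hqN w)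
  · have h1 := hq v (p w)
    have h2 := hq w (p v)
    rw [hpp] at h1 h2
    have h3 : (p v + q v) * (p w + q w) = p v * p w + q v * p w + q w * p v + q v * q w := by ring
    rw [h3, hN _ (hqN v) _ (hqN w), add_zero, map_add, map_add, h1, h2, mul_comm (p w)]
    ring

/-- Elements spanning the cotangent space of a local algebra with nilpotent maximal ideal and
trivial residue field extension generate the algebra. -/
theorem aeval_surjective_of_span {K A τ : Type*} [Field K] [CommRing A] [Algebra K A]
    [IsLocalRing A] [IsNoetherianRing A] [Fintype τ] {n : ℕ}
    (hn : IsLocalRing.maximalIdeal A ^ n = ⊥)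
    (hres : ∀ a : A, ∃ k : K, a - algebraMap K A k ∈ IsLocalRing.maximalIdeal A) {y : τ → A}
    (hym : ∀ i, y i ∈ IsLocalRing.maximalIdeal A)
    (hy : ∀ a ∈ IsLocalRing.maximalIdeal A, ∃ k : τ → K,
      a - ∑ i, k i • y i ∈ IsLocalRing.maximalIdeal A ^ 2) :
    Function.Surjective (MvPolynomial.aeval y : MvPolynomial τ K →ₐ[K] A) := by
  have hspan : IsLocalRing.maximalIdeal A ≤ Ideal.span (Set.range y) := by
    refine Submodule.le_of_le_smul_of_le_jacobson_bot (I := IsLocalRing.maximalIdeal A)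
      (IsNoetherian.noetherian _) (IsLocalRing.maximalIdeal_le_jacobson _) fun a ha => ?_
    obtain ⟨k, hk⟩ := hy a ha
    rw [pow_two, ← smul_eq_mul] at hk
    rw [← add_sub_cancel (∑ i, k i • y i) a]
    refine Submodule.add_mem_sup (Ideal.sum_mem _ fun i _ => ?_) hk
    rw [Algebra.smul_def]
    exact Ideal.mul_mem_left _ _ (Ideal.subset_span ⟨i, rfl⟩)
  let S := (MvPolynomial.aeval y : MvPolynomial τ K →ₐ[K] A).range
  have hyS : ∀ i, y i ∈ S := fun i => ⟨MvPolynomial.X i, by simp⟩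
  have happrox : ∀ j, ∀ a : A, ∃ s ∈ S, a - s ∈ IsLocalRing.maximalIdeal A ^ j := by
    intro j
    induction j with
    | zero => exact fun a => ⟨0, S.zero_mem, by simp⟩
    | succ j ih =>
      intro a
      obtain ⟨k, hk⟩ := hres a
      obtain ⟨c, hc⟩ := (Submodule.mem_span_range_iff_exists_fun A).1 (hspan hk)
      choose s hsS hs using fun i => ih (c i)
      refine ⟨algebraMap K A k + ∑ i, s i * y i,
        S.add_mem (S.algebraMap_mem k) (S.sum_mem fun i _ => S.mul_mem (hsS i) (hyS i)), ?_⟩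
      rw [← sub_sub, ← hc, ← Finset.sum_sub_distrib]
      refine Ideal.sum_mem _ fun i _ => ?_
      rw [smul_eq_mul, ← sub_mul, pow_succ]
      exact Ideal.mul_mem_mul (hs i) (hym i)
  intro a
  obtain ⟨s, hs, has⟩ := happrox n a
  rw [hn, Ideal.mem_bot, sub_eq_zero] at has
  rwa [has]

theorem exists_sub_algebraMap_mem_maximalIdeal {K A : Type*} [Field K] [CommRing A]
    [Algebra K A] [IsLocalRing A]
    (h0 : Module.finrank K (A ⧸ IsLocalRing.maximalIdeal A) = 1) (a : A) :
    ∃ k : K, a - algebraMap K A k ∈ IsLocalRing.maximalIdeal A := by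
  obtain ⟨k, hk⟩ := (finrank_eq_one_iff_of_nonzero'
    (1 : A ⧸ IsLocalRing.maximalIdeal A) one_ne_zero).1 h0 (Ideal.Quotient.mk _ a)
  refine ⟨k, Ideal.Quotient.eq.1 ?_⟩
  rw [← hk, Algebra.smul_def, mul_one]
  rfl

/-- Lifts to the maximal ideal of a basis of the cotangent space. -/
theorem exists_span_cotangent {K A : Type} [Field K] [CommRing A] [Algebra K A]
    [IsLocalRing A] {n : ℕ} (hn : n ≠ 0) (h1 : assocGradedDim K A 1 = n) :
    ∃ y : Fin n → A, (∀ i, y i ∈ IsLocalRing.maximalIdeal A) ∧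
      ∀ a ∈ IsLocalRing.maximalIdeal A, ∃ k : Fin n → K,
        a - ∑ i, k i • y i ∈ IsLocalRing.maximalIdeal A ^ 2 := by
  unfold assocGradedDim at h1
  set N := Submodule.comap ((IsLocalRing.maximalIdeal A ^ 1).restrictScalars K).subtype
        ((IsLocalRing.maximalIdeal A ^ (1 + 1)).restrictScalars K) with hN
  have := FiniteDimensional.of_finrank_pos (h1 ▸ Nat.pos_of_ne_zero hn :
    0 < Module.finrank K (_ ⧸ N))
  let b := Module.finBasisOfFinrankEq K _ h1
  choose y hy using fun i => N.mkQ_surjective (b i)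
  refine ⟨fun i => y i, fun i => by simpa using (y i).2, fun a ha => ?_⟩
  let a' : (IsLocalRing.maximalIdeal A ^ 1).restrictScalars K := ⟨a, by simpa using ha⟩
  refine ⟨b.repr (N.mkQ a'), ?_⟩
  have h : a' - ∑ i, b.repr (N.mkQ a') i • y i ∈ N := by
    rw [← Submodule.Quotient.mk_eq_zero, ← Submodule.mkQ_apply, map_sub, map_sum]
    simp only [map_smul, hy, b.sum_repr, sub_self]
  simpa [hN, a'] using h

/-- Over an algebraically closed field `K` of characteristic `0`, every local Artinian
Gorenstein `K`-algebra with residue field `K` and Hilbert function `(1,5,5,1)`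
is smoothable (with `d = 12`). -/
theorem local_gorenstein_1551_smoothable (K A : Type) [Field K] [IsAlgClosed K] [CharZero K]
    [CommRing A] [Algebra K A] [IsLocalRing A] [IsArtinianRing A]
    (h0 : Module.finrank K (A ⧸ IsLocalRing.maximalIdeal A) = 1)
    (h1 : assocGradedDim K A 1 = 5)
    (h2 : assocGradedDim K A 2 = 5)
    (h3 : assocGradedDim K A 3 = 1)
    (h4 : IsLocalRing.maximalIdeal A ^ 4 = ⊥)
    (hgor : Module.finrank K
      (((⊥ : Ideal A).colon (IsLocalRing.maximalIdeal A)).restrictScalars K) = 1) :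
    IsSmoothable K A 12 := by
  obtain ⟨hfin, hA, hm2⟩ := finrank_of_assocGradedDim h0 h1 h2 h3 h4
  obtain ⟨ψ, hψ⟩ := exists_dual_nondegenerate h4 hgor
  obtain ⟨z, hzm, hz⟩ := exists_isotropic_lift ψ hψ
    ((IsLocalRing.maximalIdeal A ^ 2).restrictScalars K)
    (fun x hx y hy => by
      have := Ideal.mul_mem_mul hx hy
      rwa [← pow_add, h4, Ideal.mem_bot] at this) (by omega)
  simp only [Submodule.restrictScalars_mem] at hzm
  have hm : ∀ {x}, x ∈ IsLocalRing.maximalIdeal A ^ 2 → x ∈ IsLocalRing.maximalIdeal A :=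
    fun hx => Ideal.pow_le_self two_ne_zero hx
  obtain ⟨y, hym, hy⟩ := exists_span_cotangent (by norm_num) h1
  obtain ⟨u, hu⟩ : IsUnit (z 1) := by
    have := hm (hzm 1)
    rw [IsLocalRing.mem_maximalIdeal, mem_nonunits_iff] at this
    by_contra hz1
    have h1 := Ideal.sub_mem _ ((IsLocalRing.mem_maximalIdeal _).2 hz1) (hm (hzm 1))
    rw [sub_sub_cancel] at h1
    exact (Ideal.ne_top_iff_one _).1 (IsLocalRing.maximalIdeal.isMaximal A).ne_top h1
  let Y : Fin 5 → A := fun i => ↑u⁻¹ * z (y i)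
  have huY : ∀ i, u * Y i = z (y i) := fun i => Units.mul_inv_cancel_left u _
  have hYm : ∀ i, Y i ∈ IsLocalRing.maximalIdeal A := fun i => by
    refine Ideal.mul_mem_left _ _ ?_
    rw [← sub_add_cancel (z (y i)) (y i)]
    exact Ideal.add_mem _ (hm (hzm _)) (hym i)
  have hYy : ∀ i, Y i - y i ∈ IsLocalRing.maximalIdeal A ^ 2 := fun i => by
    have h := Ideal.sub_mem _ (hzm (y i)) (Ideal.mul_mem_right (Y i) _ (hzm 1))
    rw [← hu, sub_mul, huY, one_mul] at h
    convert h using 1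
    ring
  refine isSmoothable_twelve hA (ψ ∘ₗ LinearMap.mulLeft K (u ^ 2 : A)) (fun a ha => ?_) Y
    (aeval_surjective_of_span h4 (exists_sub_algebraMap_mem_maximalIdeal h0) hYm fun a ha => ?_)
    (fun a b d e => ?_) ?_ (fun a => ?_) fun a b => ?_
  · have : (u ^ 2 : A) * a = 0 := hψ _ fun x => by simpa [mul_assoc] using ha x
    exact (u.isUnit.pow 2).mul_right_eq_zero.1 this
  · obtain ⟨k, hk⟩ := hy a ha
    refine ⟨k, ?_⟩
    have h : ∑ i, k i • (Y i - y i) ∈ IsLocalRing.maximalIdeal A ^ 2 :=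
      Ideal.sum_mem _ fun i _ => by
        rw [Algebra.smul_def]
        exact Ideal.mul_mem_left _ _ (hYy i)
    have := Ideal.sub_mem _ hk h
    simp only [smul_sub, Finset.sum_sub_distrib] at this
    convert this using 1
    ring
  · have := Ideal.mul_mem_mul (Ideal.mul_mem_mul (Ideal.mul_mem_mul (hYm a) (hYm b)) (hYm d))
      (hYm e)
    rwa [← pow_two, ← pow_succ, ← pow_succ, h4, Ideal.mem_bot] at this
  · have := hz 1 1
    rw [← hu] at this
    simpa [pow_two] using this
  · have := hz 1 (y a)
    rw [← huY, ← hu, ← mul_assoc] at this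
    simpa [pow_two, mul_assoc] using this
  · have := hz (y a) (y b)
    rw [← huY, ← huY, mul_mul_mul_comm] at this
    simpa [pow_two, mul_assoc] using this
end
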